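/- arXiv:0911.3850 — 2 statements merged into one kernel-verified Lean document; each statement's English description precedes it below -/
import Mathlib

section
/- Let n ∈ ℕ, ρ₁ ∈ (0,1), and let e₁, …, e_{2n} be complex numbers with |e_k| < ρ₁ for every k. Define the finite Blaschke product b(z) := ∏_{k=1}^{2n} (z - e_k)/(1 - conj(e_k)·z). Then for every z with |z| = ρ ∈ (0,1): |b(z)| ≤ exp( -2n·(1-ρ)(1-ρ₁)/(1+ρ) ). -/
open Complex Filter Set

lemma one_sub_conj_mul_ne_zero {z e : ℂ} (hz : ‖z‖ < 1) (he : ‖e‖ < 1) :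
    1 - (starRingEnd ℂ) e * z ≠ 0 := by
  intro h
  have h1 : ‖(starRingEnd ℂ) e * z‖ = 1 := by
    rw [← sub_eq_zero.mp h, norm_one]
  rw [norm_mul, RCLike.norm_conj] at h1
  nlinarith [norm_nonneg z, norm_nonneg e]

/-- The sharp upper bound for a Blaschke factor on a circle centred at the origin. -/
lemma norm_blaschke_factor_le {z e : ℂ} (hz : ‖z‖ < 1) (he : ‖e‖ < 1) :
    ‖(z - e) / (1 - (starRingEnd ℂ) e * z)‖ ≤ (‖z‖ + ‖e‖) / (1 + ‖z‖ * ‖e‖) := by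
  have hz0 := norm_nonneg z
  have he0 := norm_nonneg e
  have hre : -(‖z‖ * ‖e‖) ≤ ((starRingEnd ℂ) e * z).re := by
    have h := (abs_le.mp (Complex.abs_re_le_norm ((starRingEnd ℂ) e * z))).1
    rwa [norm_mul, RCLike.norm_conj, mul_comm ‖e‖] at h
  have hnum : ‖z - e‖ ^ 2 = ‖z‖ ^ 2 + ‖e‖ ^ 2 - 2 * ((starRingEnd ℂ) e * z).re := by
    simp only [Complex.sq_norm, Complex.normSq_apply, sub_re, sub_im, mul_re, conj_re, conj_im]
    ring
  have hden : ‖1 - (starRingEnd ℂ) e * z‖ ^ 2 =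
      1 + ‖z‖ ^ 2 * ‖e‖ ^ 2 - 2 * ((starRingEnd ℂ) e * z).re := by
    simp only [Complex.sq_norm, Complex.normSq_apply, sub_re, sub_im, mul_re, mul_im, conj_re,
      conj_im, one_re, one_im]
    ring
  have hprod : 0 ≤ (((starRingEnd ℂ) e * z).re + ‖z‖ * ‖e‖) *
      ((1 - ‖z‖ ^ 2) * (1 - ‖e‖ ^ 2)) :=
    mul_nonneg (by linarith) (mul_nonneg (by nlinarith) (by nlinarith))
  rw [norm_div, div_le_div_iff₀ (norm_pos_iff.mpr (one_sub_conj_mul_ne_zero hz he))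
    (by positivity)]
  refine le_of_sq_le_sq ?_ (by positivity)
  rw [mul_pow, mul_pow, hnum, hden]
  linarith

/-- The exponential bound for the hyperbolic sum of two radii. -/
lemma add_div_one_add_mul_le_exp {a b : ℝ} (ha : 0 ≤ a) (hb : 0 ≤ b) :
    (a + b) / (1 + a * b) ≤ Real.exp (-((1 - a) * (1 - b) / (1 + a * b))) := by
  have h : (a + b) / (1 + a * b) = -((1 - a) * (1 - b) / (1 + a * b)) + 1 := by
    field_simp
    ring
  rw [h]
  exact Real.add_one_le_exp _

/-- **Bound on a finite Blaschke product.**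
If `e₁, …, e_{2n}` lie in the disk `{|e| < ρ₁}` with `ρ₁ ∈ (0,1)`, then the Blaschke
product `b(z) = ∏ (z - e_k)/(1 - conj(e_k) z)` satisfies, for every `z` on the circle
`|z| = ρ` with `ρ ∈ (0,1)`,
`|b(z)| ≤ exp(-2n (1-ρ)(1-ρ₁)/(1+ρ))`. -/
theorem blaschke_product_bound (n : ℕ) (hn : 1 ≤ n) (ρ₁ : ℝ) (hρ₁ : ρ₁ ∈ Set.Ioo (0:ℝ) 1)
    (e : Fin (2 * n) → ℂ) (he : ∀ k, ‖e k‖ < ρ₁)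
    (ρ : ℝ) (hρ : ρ ∈ Set.Ioo (0:ℝ) 1) (z : ℂ) (hz : ‖z‖ = ρ) :
    ‖∏ k : Fin (2 * n), (z - e k) / (1 - (starRingEnd ℂ) (e k) * z)‖ ≤
      Real.exp (-(2 * n : ℝ) * ((1 - ρ) * (1 - ρ₁) / (1 + ρ))) := by
  obtain ⟨hρ0, hρ1⟩ := hρ
  subst hz
  have hfactor (k : Fin (2 * n)) : ‖(z - e k) / (1 - (starRingEnd ℂ) (e k) * z)‖ ≤
      Real.exp (-((1 - ‖z‖) * (1 - ρ₁) / (1 + ‖z‖))) := by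
    have hk : ‖e k‖ < 1 := (he k).trans hρ₁.2
    refine (norm_blaschke_factor_le hρ1 hk).trans
      ((add_div_one_add_mul_le_exp hρ0.le (norm_nonneg _)).trans ?_)
    have hz1 : 0 ≤ 1 - ‖z‖ := by linarith
    have hek : 0 ≤ 1 - ‖e k‖ := by linarith
    refine Real.exp_le_exp.mpr (neg_le_neg (div_le_div₀ (by positivity) ?_ (by positivity) ?_))
    · exact mul_le_mul_of_nonneg_left (by linarith [he k]) hz1
    · nlinarith
  rw [norm_prod]
  refine (Finset.prod_le_prod (fun k _ => norm_nonneg _) (fun k _ => hfactor k)).trans_eq ?_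
  rw [Finset.prod_const, Finset.card_univ, Fintype.card_fin, ← Real.exp_nat_mul]
  push_cast
  ring_nf
end

section
/- Let ℓ₀ be a polynomial. Then the function τ ↦ (1/(πi)) ∫_Δ ℓ₀(t)/((t-τ)·sr⁺(t)) dt, τ ∈ Δ°, coincides on Δ° with a polynomial ℓ₁ of degree strictly less than deg ℓ₀; in particular S(1/sr⁺) ≡ 0 on Δ°. Moreover, the Cauchy integral satisfies C(1/sr⁺)(z) = 1/(2·sr(z)) for all z ∈ D, where Cφ(z) := (1/(2πi)) ∫_Δ φ(t)/(t-z) dt. -/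
open Complex MeasureTheory Filter Topology Set Metric Polynomial
open scoped ENNReal NNReal

noncomputable section

/-- The segment `[-1,1]` viewed inside `ℂ`. -/
def realSeg : Set ℂ := (fun x : ℝ => (x : ℂ)) '' Set.Icc (-1) 1

/-- A closed analytic Jordan arc with endpoints `-1` and `1`: the image of `[-1,1]`
under a holomorphic univalent map defined on a neighborhood of `[-1,1]`. -/
structure AnalyticArc where
  U : Set ℂ
  Ξ : ℂ → ℂ
  isOpen_U : IsOpen U
  seg_sub : realSeg ⊆ U
  diff : DifferentiableOn ℂ Ξ U
  inj : Set.InjOn Ξ U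
  map_neg_one : Ξ (-1) = -1
  map_one : Ξ 1 = 1

/-- The arc itself. -/
def AnalyticArc.arc (A : AnalyticArc) : Set ℂ := A.Ξ '' realSeg

/-- The open arc `Δ° = Δ \ {±1}`. -/
def AnalyticArc.arcInt (A : AnalyticArc) : Set ℂ := A.arc \ {1, -1}

/-- Boundary value from the left (`+`) side of the arc. -/
def BVplus {E : Type*} [TopologicalSpace E] (Ξ : ℂ → ℂ) (f : ℂ → E) (fp : ℂ → E) : Prop :=
  ∀ x ∈ Set.Ioo (-1:ℝ) 1,
    Tendsto (fun y : ℝ => f (Ξ (x + y * Complex.I))) (𝓝[>] 0) (𝓝 (fp (Ξ (x:ℂ))))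

/-- Boundary value from the right (`-`) side of the arc. -/
def BVminus {E : Type*} [TopologicalSpace E] (Ξ : ℂ → ℂ) (f : ℂ → E) (fm : ℂ → E) : Prop :=
  ∀ x ∈ Set.Ioo (-1:ℝ) 1,
    Tendsto (fun y : ℝ => f (Ξ (x + y * Complex.I))) (𝓝[<] 0) (𝓝 (fm (Ξ (x:ℂ))))

/-- The branch of `√(z²-1)` holomorphic off the arc with `sr z / z → 1` at infinity. -/
structure SqrtBranch (A : AnalyticArc) where
  sr : ℂ → ℂ
  diff : DifferentiableOn ℂ sr A.arcᶜ
  sq : ∀ z ∈ A.arcᶜ, sr z ^ 2 = z ^ 2 - 1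
  at_inf : Tendsto (fun z => sr z / z) (Bornology.cobounded ℂ) (𝓝 1)

/-- `φ(z) = z + sr z`. -/
def SqrtBranch.φ {A : AnalyticArc} (S : SqrtBranch A) (z : ℂ) : ℂ := z + S.sr z

/-- The function `r_n` associated to a polynomial `v` with no zeros on the arc. -/
def rFun {A : AnalyticArc} (S : SqrtBranch A) (v : Polynomial ℂ) (n : ℕ) (z : ℂ) : ℂ :=
  (1 / S.φ z) ^ (2 * n - v.natDegree) *
    ((v.roots.map fun e => (S.φ z - S.φ e) / (1 - S.φ e * S.φ z)).prod)


/-- `IsPV A g τ v` : the principal value integral `∫_Δ g(t)/(t-τ) dt` exists and equals `v`,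
computed through the analytic parametrization of the arc. -/
def IsPV (A : AnalyticArc) (g : ℂ → ℂ) (τ v : ℂ) : Prop :=
  Filter.Tendsto (fun ε : ℝ =>
      ∫ x in {x ∈ Set.Icc (-1:ℝ) 1 | ε ≤ ‖A.Ξ (x:ℂ) - τ‖},
        g (A.Ξ (x:ℂ)) / (A.Ξ (x:ℂ) - τ) * deriv A.Ξ (x:ℂ))
    (𝓝[>] 0) (𝓝 v)

/-- An injective holomorphic function on an open set has nonvanishing derivative. -/
theorem deriv_ne_zero_of_injOn {U : Set ℂ} {f : ℂ → ℂ} (hU : IsOpen U)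
    (hf : DifferentiableOn ℂ f U) (hinj : InjOn f U) {z₀ : ℂ} (hz₀ : z₀ ∈ U) :
    deriv f z₀ ≠ 0 := by
  have hUn : U ∈ 𝓝 z₀ := hU.mem_nhds hz₀
  have hfa : AnalyticAt ℂ f z₀ := hf.analyticAt hUn
  have hF : AnalyticAt ℂ (fun z => f z - f z₀) z₀ := hfa.sub analyticAt_const
  have hne : ¬ ∀ᶠ z in 𝓝 z₀, f z - f z₀ = 0 := by
    intro h
    have h2 : ∀ᶠ z in 𝓝[≠] z₀, f z - f z₀ = 0 ∧ z ∈ U := (h.and hUn).filter_mono nhdsWithin_le_nhds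
    obtain ⟨z, hz, hzne⟩ := (h2.and self_mem_nhdsWithin).exists
    exact hzne (hinj hz.2 hz₀ (sub_eq_zero.1 hz.1))
  obtain ⟨n, g, hg, hg0, hfg⟩ := hF.exists_eventuallyEq_pow_smul_nonzero_iff.2 hne
  have hn0 : n ≠ 0 := by
    rintro rfl
    have := hfg.self_of_nhds
    simp at this
    exact hg0 this.symm
  set h : ℂ → ℂ := fun z => g z₀ ^ ((n : ℂ)⁻¹) * (g z / g z₀) ^ ((n : ℂ)⁻¹) with hh
  have hquot : AnalyticAt ℂ (fun z => g z / g z₀) z₀ := hg.div_const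
  have hha : AnalyticAt ℂ h z₀ :=
    analyticAt_const.mul (hquot.cpow analyticAt_const (by simp [hg0]))
  have hpow : ∀ z, h z ^ n = g z := by
    intro z
    simp only [hh, mul_pow, cpow_nat_inv_pow _ hn0]
    field_simp
  have hh0 : h z₀ ≠ 0 := fun h0 => hg0 (by rw [← hpow, h0, zero_pow hn0])
  set φ : ℂ → ℂ := fun z => (z - z₀) * h z with hφ
  have hφd : HasStrictDerivAt φ (h z₀) z₀ := by
    have h1 : HasStrictDerivAt (fun z : ℂ => z - z₀) 1 z₀ := (hasStrictDerivAt_id z₀).sub_const z₀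
    have := h1.mul hha.hasStrictDerivAt
    simpa [hφ, Function.comp_def] using! this
  have hmap : map φ (𝓝 z₀) = 𝓝 0 := by
    rw [hφd.map_nhds_eq hh0]; simp [hφ]
  have hfφ : ∀ᶠ z in 𝓝 z₀, f z - f z₀ = φ z ^ n := by
    filter_upwards [hfg] with z hz
    rw [hz, hφ]; simp [mul_pow, hpow]
  by_cases hn1 : n = 1
  · have : HasDerivAt f (h z₀) z₀ := by
      have h1 := hφd.hasDerivAt.add_const (f z₀)
      refine h1.congr_of_eventuallyEq ?_
      filter_upwards [hfφ] with z hz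
      rw [hn1, pow_one] at hz
      rw [← hz]; ring
    rw [this.deriv]; exact hh0
  exfalso
  have hV : {z | z ∈ U ∧ f z - f z₀ = φ z ^ n} ∈ 𝓝 z₀ := hfφ.mp (by filter_upwards [hUn] with z hz h; exact ⟨hz, h⟩)
  have hW := image_mem_map (m := φ) hV
  rw [hmap] at hW
  set ω : ℂ := exp (2 * Real.pi * I / n)
  have hω : IsPrimitiveRoot ω n := Complex.isPrimitiveRoot_exp n hn0
  have hω1 : ω ≠ 1 := hω.ne_one (by omega)
  have hW2 : ∀ᶠ r in 𝓝 (0:ℂ), r ∈ φ '' {z | z ∈ U ∧ f z - f z₀ = φ z ^ n} := hW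
  have hW3 : ∀ᶠ r in 𝓝 (0:ℂ), ω * r ∈ φ '' {z | z ∈ U ∧ f z - f z₀ = φ z ^ n} := by
    have : Tendsto (fun r : ℂ => ω * r) (𝓝 0) (𝓝 0) := by
      simpa using (tendsto_id (α := ℂ) (x := 𝓝 0)).const_mul ω
    exact this.eventually hW2
  obtain ⟨r, ⟨⟨z₁, ⟨hz₁, e₁⟩, rfl⟩, ⟨z₂, ⟨hz₂, e₂⟩, e⟩⟩, hr⟩ :=
    (((hW2.and hW3).filter_mono nhdsWithin_le_nhds).and (self_mem_nhdsWithin (s := {0}ᶜ))).exists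
  have : f z₁ = f z₂ := by
    have : f z₁ - f z₀ = f z₂ - f z₀ := by
      rw [e₁, e₂, e, mul_pow ω, hω.pow_eq_one, one_mul]
    simpa using this
  rw [hinj hz₁ hz₂ this] at e hr
  exact hω1 (mul_right_cancel₀ hr (by rw [one_mul]; exact e.symm))

namespace AnalyticArc
variable (A : AnalyticArc)

theorem ofReal_mem_U {x : ℝ} (hx : x ∈ Icc (-1:ℝ) 1) : (x : ℂ) ∈ A.U :=
  A.seg_sub ⟨x, hx, rfl⟩

theorem deriv_ne_zero {z : ℂ} (hz : z ∈ A.U) : deriv A.Ξ z ≠ 0 :=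
  deriv_ne_zero_of_injOn A.isOpen_U A.diff A.inj hz

theorem analyticAt {z : ℂ} (hz : z ∈ A.U) : AnalyticAt ℂ A.Ξ z :=
  A.diff.analyticAt (A.isOpen_U.mem_nhds hz)

theorem isCompact_realSeg : IsCompact realSeg := isCompact_Icc.image continuous_ofReal

theorem isCompact_arc : IsCompact A.arc :=
  isCompact_realSeg.image_of_continuousOn (A.diff.continuousOn.mono A.seg_sub)

theorem isOpen_compl_arc : IsOpen A.arcᶜ := A.isCompact_arc.isClosed.isOpen_compl

theorem mem_arc_iff {z : ℂ} (hz : z ∈ A.U) : A.Ξ z ∈ A.arc ↔ z ∈ realSeg := by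
  constructor
  · rintro ⟨w, hw, e⟩
    rwa [← A.inj (A.seg_sub hw) hz e]
  · exact fun h => ⟨z, h, rfl⟩

theorem mem_realSeg_iff {z : ℂ} : z ∈ realSeg ↔ z.im = 0 ∧ -1 ≤ z.re ∧ z.re ≤ 1 := by
  constructor
  · rintro ⟨x, hx, rfl⟩; simpa using hx
  · rintro ⟨h0, h1⟩; exact ⟨z.re, h1, by apply Complex.ext <;> simp [h0]⟩

theorem one_mem_arc : (1:ℂ) ∈ A.arc := ⟨1, mem_realSeg_iff.2 (by simp), A.map_one⟩

theorem neg_one_mem_arc : (-1:ℂ) ∈ A.arc := ⟨-1, mem_realSeg_iff.2 (by simp), A.map_neg_one⟩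

theorem convex_realSeg : Convex ℝ realSeg :=
  (convex_Icc (-1:ℝ) 1).linear_image (Complex.ofRealCLM : ℝ →L[ℝ] ℂ).toLinearMap

/-- A thickened segment with the segment removed is connected. -/
theorem isPreconnected_thickening_diff {δ : ℝ} (hδ : 0 < δ) :
    IsPreconnected (thickening δ realSeg \ realSeg) := by
  set N := thickening δ realSeg
  have hN : Convex ℝ N := convex_realSeg.thickening δ
  have e : N \ realSeg = ((N ∩ {z | 0 < z.im}) ∪ (N ∩ {z | 1 < z.re}) ∪ (N ∩ {z | z.im < 0})) ∪
      (N ∩ {z | z.re < -1}) := by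
    ext z
    simp only [Set.mem_sdiff, mem_realSeg_iff, Set.mem_union, Set.mem_inter_iff, Set.mem_ofPred_eq]
    rcases lt_trichotomy z.im 0 with h | h | h
    · simp only [h, h.ne, h.not_gt, false_and]; tauto
    · simp only [h, lt_irrefl, true_and, and_false, not_and_or, not_le]; tauto
    · simp only [h, h.ne', h.not_gt, false_and]; tauto
  have hmem : ∀ (x : ℝ) (p : ℂ), x ∈ Icc (-1:ℝ) 1 → ‖p - x‖ < δ → p ∈ N := fun x p hx hp =>
    mem_thickening_iff.2 ⟨x, ⟨x, hx, rfl⟩, by rwa [dist_eq_norm]⟩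
  have hnorm : ∀ a b : ℝ, |a| ≤ δ / 4 → |b| ≤ δ / 4 → ‖(a : ℂ) + b * I‖ < δ := by
    intro a b ha hb
    refine (norm_add_le _ _).trans_lt ?_
    simp only [norm_real, norm_mul, norm_I, mul_one, Real.norm_eq_abs]
    linarith
  have hd : |δ / 4| ≤ δ / 4 := (abs_of_pos (by linarith)).le
  have hd' : |-(δ / 4)| ≤ δ / 4 := by rw [abs_neg]; exact hd
  have cU : IsPreconnected (N ∩ {z | 0 < z.im}) :=
    (hN.inter (convex_halfSpace_im_gt 0)).isPreconnected
  have cD : IsPreconnected (N ∩ {z | z.im < 0}) :=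
    (hN.inter (convex_halfSpace_im_lt 0)).isPreconnected
  have cR : IsPreconnected (N ∩ {z | 1 < z.re}) :=
    (hN.inter (convex_halfSpace_re_gt 1)).isPreconnected
  have cL : IsPreconnected (N ∩ {z | z.re < -1}) :=
    (hN.inter (convex_halfSpace_re_lt (-1))).isPreconnected
  have m1 := fun b hb => hmem 1 (1 + ((δ/4 : ℝ) + (b:ℝ) * I)) (by simp)
    (by have := hnorm _ b hd hb; simpa using this)
  have m2 := hmem (-1) (-1 + ((-(δ/4) : ℝ) + (δ/4 : ℝ) * I)) (by simp)
    (by have := hnorm _ _ hd' hd; simpa using this)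
  rw [e]
  refine IsPreconnected.union _ (Or.inl (Or.inl ⟨m2, ?_⟩)) ⟨m2, ?_⟩ (IsPreconnected.union _
    (Or.inr ⟨m1 _ hd', ?_⟩) ⟨m1 _ hd', ?_⟩ (IsPreconnected.union _
      ⟨m1 _ hd, ?_⟩ ⟨m1 _ hd, ?_⟩ cU cR) cD) cL
  all_goals simp; try linarith

/-- The complement of an analytic arc is connected. -/
theorem isPreconnected_compl_arc : IsPreconnected A.arcᶜ := by
  obtain ⟨δ, hδ, hδU⟩ := isCompact_realSeg.exists_thickening_subset_open A.isOpen_U A.seg_sub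
  set N := thickening δ realSeg
  have hsN : realSeg ⊆ N := self_subset_thickening hδ _
  have hW : IsPreconnected (A.Ξ '' (N \ realSeg)) :=
    (isPreconnected_thickening_diff hδ).image _
      (A.diff.continuousOn.mono (sdiff_subset.trans hδU))
  have hopen : IsOpen (A.Ξ '' N) := by
    rw [isOpen_iff_mem_nhds]
    rintro _ ⟨z, hz, rfl⟩
    rw [← ((A.analyticAt (hδU hz)).hasStrictDerivAt).map_nhds_eq (A.deriv_ne_zero (hδU hz))]
    exact image_mem_map (isOpen_thickening.mem_nhds hz)
  have hWe : A.Ξ '' (N \ realSeg) = A.Ξ '' N ∩ A.arcᶜ := by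
    ext w
    constructor
    · rintro ⟨z, hz, rfl⟩
      exact ⟨⟨z, hz.1, rfl⟩, fun h => hz.2 ((A.mem_arc_iff (hδU hz.1)).1 h)⟩
    · rintro ⟨⟨z, hz, rfl⟩, h⟩
      exact ⟨z, ⟨hz, fun h' => h ((A.mem_arc_iff (hδU hz)).2 h')⟩, rfl⟩
  have hmeet : ∀ z ∈ A.arcᶜ, (connectedComponentIn A.arcᶜ z ∩ A.Ξ '' N).Nonempty := by
    intro z hz
    by_contra hempty
    rw [not_nonempty_iff_eq_empty, ← disjoint_iff_inter_eq_empty] at hempty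
    set C := connectedComponentIn A.arcᶜ z
    have hCo : IsOpen C := A.isOpen_compl_arc.connectedComponentIn
    have hzC : z ∈ C := mem_connectedComponentIn hz
    have hcl : closure C ⊆ C := by
      have h1 : closure C ⊆ A.arcᶜ := by
        intro p hp hpa
        have h2 : A.arc ⊆ A.Ξ '' N := image_mono hsN
        exact (hempty.closure_left hopen).le_bot ⟨hp, h2 hpa⟩
      exact isPreconnected_connectedComponentIn.closure.subset_connectedComponentIn
        (subset_closure hzC) h1
    have hclosed : IsClosed C := isClosed_of_closure_subset hcl
    have : C = univ := IsClopen.eq_univ ⟨hclosed, hCo⟩ ⟨z, hzC⟩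
    have h1 : (1:ℂ) ∈ C := this ▸ mem_univ _
    exact connectedComponentIn_subset _ _ h1 A.one_mem_arc
  have hsub : ∀ z ∈ A.arcᶜ, A.Ξ '' (N \ realSeg) ⊆ connectedComponentIn A.arcᶜ z := by
    intro z hz
    obtain ⟨p, hpC, hpN⟩ := hmeet z hz
    have hp : p ∈ A.arcᶜ := connectedComponentIn_subset _ _ hpC
    rw [connectedComponentIn_eq hpC]
    exact hW.subset_connectedComponentIn (hWe ▸ ⟨hpN, hp⟩) (hWe ▸ inter_subset_right)
  refine isPreconnected_of_forall_pair fun x hx y hy => ?_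
  obtain ⟨p, hpC, hpN⟩ := hmeet x hx
  have hpW : p ∈ A.Ξ '' (N \ realSeg) := hWe ▸ ⟨hpN, connectedComponentIn_subset _ _ hpC⟩
  have hxy : connectedComponentIn A.arcᶜ x = connectedComponentIn A.arcᶜ y :=
    (connectedComponentIn_eq (hsub x hx hpW)).trans (connectedComponentIn_eq (hsub y hy hpW)).symm
  exact ⟨_, connectedComponentIn_subset _ x, mem_connectedComponentIn hx,
    hxy ▸ mem_connectedComponentIn hy, isPreconnected_connectedComponentIn⟩

theorem hasDerivAt {x : ℝ} (hx : x ∈ Icc (-1:ℝ) 1) :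
    HasDerivAt (fun x : ℝ => A.Ξ x) (deriv A.Ξ x) x :=
  ((A.analyticAt (A.ofReal_mem_U hx)).differentiableAt.hasDerivAt).comp_ofReal

theorem continuousOn_Icc : ContinuousOn (fun x : ℝ => A.Ξ x) (Icc (-1) 1) :=
  fun _ hx => (A.hasDerivAt hx).continuousAt.continuousWithinAt

theorem continuousOn_deriv_Icc : ContinuousOn (fun x : ℝ => deriv A.Ξ x) (Icc (-1) 1) :=
  fun _ hx => ((A.analyticAt (A.ofReal_mem_U hx)).deriv.continuousAt.comp
    continuous_ofReal.continuousAt).continuousWithinAt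

theorem tendsto_vertical (x : ℝ) : Tendsto (fun y : ℝ => (x : ℂ) + y * I) (𝓝 0) (𝓝 (x : ℂ)) := by
  have : Continuous fun y : ℝ => (x : ℂ) + y * I := by fun_prop
  simpa using this.tendsto 0

theorem eventually_mem_compl_arc {x : ℝ} (hx : x ∈ Icc (-1:ℝ) 1) :
    ∀ᶠ y : ℝ in 𝓝[≠] 0, A.Ξ (x + y * I) ∈ A.arcᶜ := by
  have h1 : ∀ᶠ y : ℝ in 𝓝 0, (x : ℂ) + y * I ∈ A.U :=
    (tendsto_vertical x).eventually (A.isOpen_U.mem_nhds (A.ofReal_mem_U hx))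
  filter_upwards [h1.filter_mono nhdsWithin_le_nhds, self_mem_nhdsWithin] with y hy hy0
  rw [Set.mem_compl_iff, A.mem_arc_iff hy, mem_realSeg_iff]
  intro h
  exact hy0 (by simpa using h.1)

theorem continuousAt_Ξ {x : ℝ} (hx : x ∈ Icc (-1:ℝ) 1) : ContinuousAt A.Ξ x :=
  (A.analyticAt (A.ofReal_mem_U hx)).continuousAt

theorem Ξ_ofReal_inj {x y : ℝ} (hx : x ∈ Icc (-1:ℝ) 1) (hy : y ∈ Icc (-1:ℝ) 1)
    (h : A.Ξ x = A.Ξ y) : x = y :=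
  ofReal_injective (A.inj (A.ofReal_mem_U hx) (A.ofReal_mem_U hy) h)

theorem sq_sub_one_ne_zero {x : ℝ} (hx : x ∈ Ioo (-1:ℝ) 1) : A.Ξ x ^ 2 - 1 ≠ 0 := by
  have h1 : A.Ξ x - 1 ≠ 0 := fun h => hx.2.ne
    (A.Ξ_ofReal_inj (Ioo_subset_Icc_self hx) (by simp) (by simpa [A.map_one] using sub_eq_zero.1 h))
  have h2 : A.Ξ x + 1 ≠ 0 := fun h => hx.1.ne'
    (A.Ξ_ofReal_inj (Ioo_subset_Icc_self hx) (by simp)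
      (by simpa [A.map_neg_one] using eq_neg_of_add_eq_zero_left h))
  rw [show A.Ξ x ^ 2 - 1 = (A.Ξ x - 1) * (A.Ξ x + 1) by ring]
  exact mul_ne_zero h1 h2

/-- The parametrization is bi-Lipschitz from below, locally uniformly in one variable. -/
theorem exists_le_norm_sub {x₀ : ℝ} (hx₀ : x₀ ∈ Icc (-1:ℝ) 1) :
    ∃ b > 0, ∀ᶠ ζ in 𝓝 (x₀ : ℂ), ∀ x ∈ Icc (-1:ℝ) 1, b * ‖(x : ℂ) - ζ‖ ≤ ‖A.Ξ x - A.Ξ ζ‖ := by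
  have hs := (A.analyticAt (A.ofReal_mem_U hx₀)).hasStrictDerivAt
  set d := deriv A.Ξ x₀
  have hd : 0 < ‖d‖ := norm_pos_iff.2 (A.deriv_ne_zero (A.ofReal_mem_U hx₀))
  have h1 := hs.isLittleO.def (half_pos hd)
  rw [nhds_prod_eq, Filter.eventually_prod_self_iff'] at h1
  obtain ⟨t, ht, h1⟩ := h1
  obtain ⟨η, hη, hηt⟩ := Metric.mem_nhds_iff.1 ht
  have hK : IsCompact (Icc (-1:ℝ) 1 ∩ {x | η ≤ |x - x₀|}) :=
    isCompact_Icc.inter_right (isClosed_le continuous_const (by fun_prop))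
  have hcont : ContinuousOn (fun x : ℝ => ‖A.Ξ x - A.Ξ x₀‖) (Icc (-1:ℝ) 1 ∩ {x | η ≤ |x - x₀|}) :=
    ((A.continuousOn_Icc.sub continuousOn_const).norm).mono inter_subset_left
  obtain ⟨m, hm, hmK⟩ : ∃ m > 0, ∀ x ∈ Icc (-1:ℝ) 1 ∩ {x | η ≤ |x - x₀|},
      m ≤ ‖A.Ξ x - A.Ξ x₀‖ := by
    refine hK.exists_forall_le' hcont fun x hx => ?_
    rw [norm_pos_iff, sub_ne_zero]
    intro h
    have := A.Ξ_ofReal_inj hx.1 hx₀ h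
    have h2 := hx.2
    simp [this] at h2
    linarith
  have hc : ∀ᶠ ζ in 𝓝 (x₀ : ℂ), ‖A.Ξ ζ - A.Ξ x₀‖ < m / 2 := by
    have := (A.continuousAt_Ξ hx₀).eventually (Metric.ball_mem_nhds _ (half_pos hm))
    filter_upwards [this] with ζ hζ using by rwa [← dist_eq_norm]
  refine ⟨min (‖d‖ / 2) (m / 6), by positivity, ?_⟩
  filter_upwards [hc, ht, Metric.ball_mem_nhds _ one_pos] with ζ hζ hζt hζ1 x hx
  by_cases hxη : |x - x₀| < η
  · have hxt : (x : ℂ) ∈ t := hηt (by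
      rw [mem_ball, dist_eq_norm, ← ofReal_sub, norm_real]; exact hxη)
    have h2 := h1 _ hxt _ hζt
    simp only [smul_eq_mul, ContinuousLinearMap.toSpanSingleton_apply] at h2
    have h3 : ‖((x : ℂ) - ζ) * d‖ ≤ ‖A.Ξ x - A.Ξ ζ‖ + ‖d‖ / 2 * ‖(x : ℂ) - ζ‖ := by
      have := norm_sub_le (A.Ξ x - A.Ξ ζ) (A.Ξ x - A.Ξ ζ - ((x : ℂ) - ζ) * d)
      rw [sub_sub_cancel] at this
      linarith
    rw [norm_mul] at h3
    have h4 := mul_le_mul_of_nonneg_right (min_le_left (‖d‖ / 2) (m / 6)) (norm_nonneg ((x : ℂ) - ζ))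
    linarith
  · have h2 := hmK x ⟨hx, not_lt.1 hxη⟩
    have h3 : ‖A.Ξ x - A.Ξ x₀‖ ≤ ‖A.Ξ x - A.Ξ ζ‖ + ‖A.Ξ ζ - A.Ξ x₀‖ :=
      norm_sub_le_norm_sub_add_norm_sub _ _ _
    have h4 : ‖(x : ℂ) - ζ‖ ≤ 3 := by
      have h5 : ‖(x : ℂ) - ζ‖ ≤ ‖(x : ℂ) - x₀‖ + ‖(x₀ : ℂ) - ζ‖ :=
        norm_sub_le_norm_sub_add_norm_sub _ _ _
      have h6 : ‖(x : ℂ) - x₀‖ ≤ 2 := by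
        rw [← ofReal_sub, norm_real, Real.norm_eq_abs, abs_le]
        constructor <;> linarith [hx.1, hx.2, hx₀.1, hx₀.2]
      rw [mem_ball, dist_comm, dist_eq_norm] at hζ1
      linarith
    have h4 := mul_le_mul (min_le_right (‖d‖ / 2) (m / 6)) h4 (norm_nonneg _) (by positivity)
    linarith

end AnalyticArc

namespace SqrtBranch
variable {A : AnalyticArc} (S : SqrtBranch A)

theorem ne_zero {z : ℂ} (hz : z ∈ A.arcᶜ) : S.sr z ≠ 0 := by
  intro h
  have h1 := S.sq z hz
  rw [h] at h1
  have : (z - 1) * (z + 1) = 0 := by linear_combination -h1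
  rcases mul_eq_zero.1 this with h | h
  · exact hz ((sub_eq_zero.1 h) ▸ A.one_mem_arc)
  · exact hz ((eq_neg_of_add_eq_zero_left h) ▸ A.neg_one_mem_arc)

variable {S} {srp : ℂ → ℂ} (hsrp : BVplus A.Ξ S.sr srp)
include hsrp

theorem boundary_sq {x : ℝ} (hx : x ∈ Ioo (-1:ℝ) 1) : srp (A.Ξ x) ^ 2 = A.Ξ x ^ 2 - 1 := by
  have hx' := Ioo_subset_Icc_self hx
  have h1 : Tendsto (fun y : ℝ => S.sr (A.Ξ (x + y * I)) ^ 2) (𝓝[>] 0) (𝓝 (srp (A.Ξ x) ^ 2)) :=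
    (hsrp x hx).pow 2
  have h2 : Tendsto (fun y : ℝ => A.Ξ (x + y * I) ^ 2 - 1) (𝓝[>] 0) (𝓝 (A.Ξ x ^ 2 - 1)) :=
    ((((A.continuousAt_Ξ hx').tendsto.comp (AnalyticArc.tendsto_vertical x)).pow 2).sub_const
      1).mono_left nhdsWithin_le_nhds
  refine tendsto_nhds_unique h1 (h2.congr' ?_)
  filter_upwards [(A.eventually_mem_compl_arc hx').filter_mono
    (nhdsWithin_mono _ fun y (hy : 0 < y) => hy.ne')] with y hy
  exact (S.sq _ hy).symm

theorem boundary_ne_zero {x : ℝ} (hx : x ∈ Ioo (-1:ℝ) 1) : srp (A.Ξ x) ≠ 0 := by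
  intro h
  have := boundary_sq hsrp hx
  rw [h] at this
  exact A.sq_sub_one_ne_zero hx (by rw [← this]; simp)

theorem boundary_hasDerivAt {x₁ : ℝ} (hx : x₁ ∈ Ioo (-1:ℝ) 1) :
    HasDerivAt (fun x : ℝ => srp (A.Ξ x)) (A.Ξ x₁ * deriv A.Ξ x₁ / srp (A.Ξ x₁)) x₁ := by
  have hx' := Ioo_subset_Icc_self hx
  set w₁ := srp (A.Ξ x₁)
  have hw₁ : w₁ ≠ 0 := boundary_ne_zero hsrp hx
  set v := A.Ξ x₁ ^ 2 - 1
  have hv : v ≠ 0 := A.sq_sub_one_ne_zero hx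
  have hwv : w₁ ^ 2 = v := boundary_sq hsrp hx
  set q : ℂ → ℂ := fun ζ => (A.Ξ ζ ^ 2 - 1) / v
  have hq : ∀ ζ ∈ A.U, DifferentiableAt ℂ q ζ := fun ζ hζ =>
    (((A.analyticAt hζ).differentiableAt.pow 2).sub_const 1).div_const v
  have hq1 : q x₁ = 1 := div_self hv
  have hU := A.ofReal_mem_U hx'
  have hev : ∀ᶠ ζ in 𝓝 (x₁ : ℂ), ζ ∈ A.U ∧ q ζ ∈ slitPlane ∧ ζ.re ∈ Ioo (-1:ℝ) 1 := by
    refine (A.isOpen_U.eventually_mem hU).and (((hq _ hU).continuousAt.eventually_mem ?_).and ?_)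
    · rw [hq1]; exact isOpen_slitPlane.mem_nhds one_mem_slitPlane
    · exact continuous_re.continuousAt.eventually_mem (isOpen_Ioo.mem_nhds (by simpa using hx))
  obtain ⟨ρ, hρ, hB⟩ := Metric.eventually_nhds_iff_ball.1 hev
  set W : ℂ → ℂ := fun ζ => w₁ * q ζ ^ (((2 : ℕ) : ℂ)⁻¹)
  have hWd : ∀ ζ ∈ ball (x₁ : ℂ) ρ, DifferentiableAt ℂ W ζ := fun ζ hζ =>
    ((hq ζ (hB ζ hζ).1).cpow_const (hB ζ hζ).2.1).const_mul w₁
  have hWsq : ∀ ζ, W ζ ^ 2 = A.Ξ ζ ^ 2 - 1 := by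
    intro ζ
    simp only [W, q, mul_pow, cpow_nat_inv_pow _ two_ne_zero, hwv]
    field_simp
  set P := ball (x₁ : ℂ) ρ ∩ {z | 0 < z.im}
  have hP : IsPreconnected P := ((convex_ball _ _).inter (convex_halfSpace_im_gt 0)).isPreconnected
  have hPc : ∀ ζ ∈ P, A.Ξ ζ ∈ A.arcᶜ := fun ζ hζ h =>
    hζ.2.ne' (AnalyticArc.mem_realSeg_iff.1 ((A.mem_arc_iff (hB ζ hζ.1).1).1 h)).1
  have hlim : ∀ s : ℂ, EqOn (fun ζ => S.sr (A.Ξ ζ)) (fun ζ => s * W ζ) P →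
      ∀ x : ℝ, (x : ℂ) ∈ ball (x₁ : ℂ) ρ → srp (A.Ξ x) = s * W x := by
    intro s hs x hxB
    have hxI : x ∈ Ioo (-1:ℝ) 1 := by simpa using (hB _ hxB).2.2
    have h2 : Tendsto (fun y : ℝ => s * W (x + y * I)) (𝓝[>] 0) (𝓝 (s * W x)) :=
      (((hWd _ hxB).continuousAt.tendsto.comp (AnalyticArc.tendsto_vertical x)).const_mul s).mono_left
        nhdsWithin_le_nhds
    refine tendsto_nhds_unique (hsrp x hxI) (h2.congr' ?_)
    have h3 : ∀ᶠ y : ℝ in 𝓝 0, (x : ℂ) + y * I ∈ ball (x₁ : ℂ) ρ :=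
      (AnalyticArc.tendsto_vertical x).eventually (isOpen_ball.mem_nhds hxB)
    filter_upwards [h3.filter_mono nhdsWithin_le_nhds, self_mem_nhdsWithin] with y hy hy0
    exact (hs ⟨hy, by simpa using hy0⟩).symm
  have hW1 : W x₁ = w₁ := by simp [W, hq1]
  have hmem : (x₁ : ℂ) ∈ ball (x₁ : ℂ) ρ := mem_ball_self hρ
  have hwW : ∀ x : ℝ, (x : ℂ) ∈ ball (x₁ : ℂ) ρ → srp (A.Ξ x) = W x := by
    rcases hP.eq_or_eq_neg_of_sq_eq (f := fun ζ => S.sr (A.Ξ ζ)) (g := W)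
      (S.diff.continuousOn.comp (fun ζ hζ =>
        ((A.analyticAt (hB ζ hζ.1).1).continuousAt.continuousWithinAt)) hPc)
      (fun ζ hζ => (hWd ζ hζ.1).continuousAt.continuousWithinAt)
      (fun ζ hζ => by
        simp only [Pi.pow_apply, hWsq]; exact S.sq _ (hPc ζ hζ))
      (fun {ζ} hζ h0 => by
        have h1 := S.sq _ (hPc ζ hζ)
        rw [← hWsq, h0] at h1
        exact S.ne_zero (hPc ζ hζ) (by simpa using h1)) with h | h
    · intro x hx
      simpa using hlim 1 (by simpa using h) x hx
    · have h1 := hlim (-1) (fun ζ hζ => by simpa using h hζ) x₁ hmem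
      rw [hW1] at h1
      exact absurd (self_eq_neg.1 (h1.trans (neg_one_mul _))) hw₁
  have hevW : ∀ᶠ x : ℝ in 𝓝 x₁, srp (A.Ξ x) = W x := by
    have := continuous_ofReal.continuousAt.eventually (isOpen_ball.mem_nhds hmem)
    filter_upwards [this] with x hx using hwW x hx
  have hd : HasDerivAt (fun x : ℝ => srp (A.Ξ x)) (deriv W x₁) x₁ :=
    ((hWd _ hmem).hasDerivAt.comp_ofReal).congr_of_eventuallyEq hevW
  have hsq1 : HasDerivAt (fun x : ℝ => srp (A.Ξ x) ^ 2) (2 * w₁ * deriv W x₁) x₁ := by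
    simpa using hd.fun_pow 2
  have hsq2 : HasDerivAt (fun x : ℝ => srp (A.Ξ x) ^ 2) (2 * A.Ξ x₁ * deriv A.Ξ x₁) x₁ := by
    have : HasDerivAt (fun x : ℝ => A.Ξ x ^ 2 - 1) (2 * A.Ξ x₁ * deriv A.Ξ x₁) x₁ := by
      simpa using ((A.hasDerivAt hx').fun_pow 2).sub_const 1
    refine this.congr_of_eventuallyEq ?_
    filter_upwards [isOpen_Ioo.mem_nhds hx] with x hx using boundary_sq hsrp hx
  have := hsq1.unique hsq2
  convert hd using 1
  rw [div_eq_iff hw₁]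
  linear_combination -this / 2

theorem boundary_continuousOn : ContinuousOn (fun x : ℝ => srp (A.Ξ x)) (Ioo (-1) 1) :=
  fun _ hx => (boundary_hasDerivAt hsrp hx).continuousAt.continuousWithinAt

theorem density_continuousOn :
    ContinuousOn (fun x : ℝ => deriv A.Ξ x / srp (A.Ξ x)) (Ioo (-1) 1) :=
  (A.continuousOn_deriv_Icc.mono Ioo_subset_Icc_self).div (boundary_continuousOn hsrp)
    fun _ hx => boundary_ne_zero hsrp hx

/-- The density `deriv Ξ / sr⁺` of the weighted arc measure is integrable. -/
theorem density_integrableOn :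
    IntegrableOn (fun x : ℝ => deriv A.Ξ x / srp (A.Ξ x)) (Ioo (-1) 1) := by
  obtain ⟨b₁, hb₁, h₁⟩ := A.exists_le_norm_sub (x₀ := 1) (by simp)
  obtain ⟨b₂, hb₂, h₂⟩ := A.exists_le_norm_sub (x₀ := -1) (by simp)
  obtain ⟨M, hM⟩ := isCompact_Icc.exists_bound_of_continuousOn A.continuousOn_deriv_Icc
  have hint : IntegrableOn (fun x : ℝ => M * (√(b₁ * b₂))⁻¹ * √(1 - x ^ 2)⁻¹) (Ioo (-1) 1) := by
    have := Polynomial.Chebyshev.intervalIntegrable_sqrt_one_sub_sq_inv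
    rw [intervalIntegrable_iff, uIoc_of_le (by norm_num)] at this
    exact (this.mono_set Ioo_subset_Ioc_self).const_mul _
  refine hint.mono' ((density_continuousOn hsrp).aestronglyMeasurable measurableSet_Ioo) ?_
  filter_upwards [ae_restrict_mem measurableSet_Ioo] with x hx
  have hx' := Ioo_subset_Icc_self hx
  have e₁ := h₁.self_of_nhds x hx'
  have e₂ := h₂.self_of_nhds x hx'
  rw [ofReal_one, A.map_one, ← ofReal_one, ← ofReal_sub, norm_real, Real.norm_eq_abs,
    abs_sub_comm, abs_of_pos (by linarith [hx.2]), ofReal_one] at e₁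
  rw [ofReal_neg, ofReal_one, A.map_neg_one, sub_neg_eq_add, ← ofReal_one, ← ofReal_add, norm_real,
    Real.norm_eq_abs, abs_of_pos (by linarith [hx.1]), ofReal_one, sub_neg_eq_add] at e₂
  have hpos : 0 < 1 - x ^ 2 := by nlinarith [hx.1, hx.2]
  have hle : √(b₁ * b₂) * √(1 - x ^ 2) ≤ ‖srp (A.Ξ x)‖ := by
    rw [← Real.sqrt_mul (by positivity), ← Real.sqrt_sq (norm_nonneg (srp (A.Ξ x)))]
    refine Real.sqrt_le_sqrt ?_
    rw [← norm_pow, boundary_sq hsrp hx,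
      show A.Ξ x ^ 2 - 1 = (A.Ξ x - 1) * (A.Ξ x + 1) by ring, norm_mul]
    have := mul_le_mul e₁ e₂ (mul_nonneg hb₂.le (by linarith [hx.1])) (norm_nonneg _)
    linarith
  have hM0 : 0 ≤ M := (norm_nonneg _).trans (hM x hx')
  have hs0 : 0 < √(b₁ * b₂) * √(1 - x ^ 2) := by positivity
  rw [norm_div, Real.sqrt_inv, mul_assoc, ← mul_inv, ← div_eq_mul_inv]
  exact div_le_div₀ hM0 (hM x hx') hs0 hle

end SqrtBranch

namespace AnalyticArc
variable (A : AnalyticArc)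

theorem exists_le_norm_sub_of_mem_compl {z : ℂ} (hz : z ∈ A.arcᶜ) :
    ∃ d > 0, ∀ z' ∈ ball z d, ∀ x ∈ Icc (-1:ℝ) 1, d ≤ ‖A.Ξ x - z'‖ := by
  obtain ⟨ρ, hρ, hB⟩ := Metric.isOpen_iff.1 A.isOpen_compl_arc z hz
  refine ⟨ρ / 2, half_pos hρ, fun z' hz' x hx => ?_⟩
  by_contra! h
  refine (show A.Ξ x ∈ A.arcᶜ from hB ?_) ⟨x, ⟨x, hx, rfl⟩, rfl⟩
  rw [mem_ball] at hz' ⊢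
  rw [← dist_eq_norm] at h
  linarith [dist_triangle (A.Ξ x) z' z]

theorem aestronglyMeasurable_Ioo :
    AEStronglyMeasurable (fun x : ℝ => A.Ξ x) (volume.restrict (Ioo (-1) 1)) :=
  (A.continuousOn_Icc.mono Ioo_subset_Icc_self).aestronglyMeasurable measurableSet_Ioo

theorem sub_ne_zero_of_mem_compl {z : ℂ} (hz : z ∈ A.arcᶜ) {x : ℝ} (hx : x ∈ Icc (-1:ℝ) 1) :
    A.Ξ x - z ≠ 0 := fun h => hz ⟨x, ⟨x, hx, rfl⟩, sub_eq_zero.1 h⟩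

end AnalyticArc

namespace SqrtBranch
variable {A : AnalyticArc} {S : SqrtBranch A} {srp : ℂ → ℂ} (hsrp : BVplus A.Ξ S.sr srp)
include hsrp

theorem density_aemeasurable :
    AEMeasurable (fun x : ℝ => deriv A.Ξ x / srp (A.Ξ x)) (volume.restrict (Ioo (-1) 1)) :=
  (density_integrableOn hsrp).aestronglyMeasurable.aemeasurable

theorem cauchy_integrableOn {z : ℂ} (hz : z ∈ A.arcᶜ) :
    IntegrableOn (fun x : ℝ => deriv A.Ξ x / srp (A.Ξ x) / (A.Ξ x - z)) (Ioo (-1) 1) := by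
  obtain ⟨d, hd, h⟩ := A.exists_le_norm_sub_of_mem_compl hz
  refine ((density_integrableOn hsrp).norm.const_mul d⁻¹).mono'
    ((density_aemeasurable hsrp).div
      (A.aestronglyMeasurable_Ioo.aemeasurable.sub aemeasurable_const)).aestronglyMeasurable ?_
  filter_upwards [ae_restrict_mem measurableSet_Ioo] with x hx
  have := h z (mem_ball_self hd) x (Ioo_subset_Icc_self hx)
  rw [norm_div, div_eq_inv_mul]
  gcongr

theorem cauchy_hasDerivAt {z : ℂ} (hz : z ∈ A.arcᶜ) :
    IntegrableOn (fun x : ℝ => deriv A.Ξ x / srp (A.Ξ x) / (A.Ξ x - z) ^ 2) (Ioo (-1) 1) ∧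
    HasDerivAt (fun z => ∫ x in Ioo (-1:ℝ) 1, deriv A.Ξ x / srp (A.Ξ x) / (A.Ξ x - z))
      (∫ x in Ioo (-1:ℝ) 1, deriv A.Ξ x / srp (A.Ξ x) / (A.Ξ x - z) ^ 2) z := by
  obtain ⟨d, hd, h⟩ := A.exists_le_norm_sub_of_mem_compl hz
  have hm : ∀ z, AEMeasurable (fun x : ℝ => A.Ξ x - z) (volume.restrict (Ioo (-1:ℝ) 1)) := fun z =>
    A.aestronglyMeasurable_Ioo.aemeasurable.sub aemeasurable_const
  refine hasDerivAt_integral_of_dominated_loc_of_deriv_le (𝕜 := ℂ)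
    (μ := volume.restrict (Ioo (-1:ℝ) 1))
    (F := fun z (x : ℝ) => deriv A.Ξ x / srp (A.Ξ x) / (A.Ξ x - z))
    (bound := fun x : ℝ => (d ^ 2)⁻¹ * ‖deriv A.Ξ x / srp (A.Ξ x)‖)
    (F' := fun z (x : ℝ) => deriv A.Ξ x / srp (A.Ξ x) / (A.Ξ x - z) ^ 2)
    (ball_mem_nhds z hd) ?_ (cauchy_integrableOn hsrp hz) ?_ ?_ ?_ ?_
  · exact Eventually.of_forall fun z =>
      ((density_aemeasurable hsrp).div (hm z)).aestronglyMeasurable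
  · exact ((density_aemeasurable hsrp).div ((hm z).pow_const 2)).aestronglyMeasurable
  · filter_upwards [ae_restrict_mem measurableSet_Ioo] with x hx z' hz'
    have := h z' hz' x (Ioo_subset_Icc_self hx)
    rw [norm_div, div_eq_inv_mul, norm_pow]
    gcongr
  · exact (density_integrableOn hsrp).norm.const_mul _
  · filter_upwards [ae_restrict_mem measurableSet_Ioo] with x hx z' hz'
    have h0 : A.Ξ x - z' ≠ 0 := norm_pos_iff.1 (hd.trans_le (h z' hz' x (Ioo_subset_Icc_self hx)))
    have h1 : HasDerivAt (fun z : ℂ => A.Ξ x - z) (-1) z' := by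
      simpa using (hasDerivAt_id z').const_sub (A.Ξ x)
    have := (h1.fun_inv h0).const_mul (deriv A.Ξ x / srp (A.Ξ x))
    simpa [div_eq_mul_inv] using this

/-- The differential equation satisfied by the Cauchy integral of `1/sr⁺`. -/
theorem cauchy_ode {z : ℂ} (hz : z ∈ A.arcᶜ) :
    (z ^ 2 - 1) * (∫ x in Ioo (-1:ℝ) 1, deriv A.Ξ x / srp (A.Ξ x) / (A.Ξ x - z) ^ 2) +
      z * (∫ x in Ioo (-1:ℝ) 1, deriv A.Ξ x / srp (A.Ξ x) / (A.Ξ x - z)) = 0 := by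
  have hi1 := (cauchy_hasDerivAt hsrp hz).1
  have hi2 := cauchy_integrableOn hsrp hz
  set w : ℝ → ℂ := (Ioo (-1:ℝ) 1).indicator fun x => srp (A.Ξ x)
  have hwn : ∀ x ∈ Icc (-1:ℝ) 1, ‖w x‖ = √‖A.Ξ x ^ 2 - 1‖ := by
    intro x hx
    by_cases h : x ∈ Ioo (-1:ℝ) 1
    · simp only [w, indicator_of_mem h]
      rw [← boundary_sq hsrp h, norm_pow, Real.sqrt_sq (norm_nonneg _)]
    · have : x = -1 ∨ x = 1 := by
        by_contra! h2
        exact h ⟨lt_of_le_of_ne hx.1 h2.1.symm, lt_of_le_of_ne hx.2 h2.2⟩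
      simp only [w, indicator_of_notMem h]
      rcases this with rfl | rfl
      · simp [A.map_neg_one]
      · simp [A.map_one]
  have hwd : ∀ x ∈ Ioo (-1:ℝ) 1,
      HasDerivAt w (A.Ξ x * deriv A.Ξ x / srp (A.Ξ x)) x := fun x hx => by
    refine (boundary_hasDerivAt hsrp hx).congr_of_eventuallyEq ?_
    filter_upwards [isOpen_Ioo.mem_nhds hx] with y hy using indicator_of_mem hy _
  have hwc : ContinuousOn w (Icc (-1) 1) := by
    intro x hx
    by_cases h : x ∈ Ioo (-1:ℝ) 1
    · exact (hwd x h).continuousAt.continuousWithinAt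
    · have hw0 : w x = 0 := indicator_of_notMem h _
      rw [ContinuousWithinAt, hw0, tendsto_zero_iff_norm_tendsto_zero]
      have h1 : ContinuousWithinAt (fun x : ℝ => √‖A.Ξ x ^ 2 - 1‖) (Icc (-1) 1) x :=
        (((A.continuousOn_Icc.pow 2).sub continuousOn_const).norm.sqrt) x hx
      have h2 := h1.tendsto
      rw [← hwn x hx, hw0, norm_zero] at h2
      refine h2.congr' ?_
      filter_upwards [self_mem_nhdsWithin] with y hy using (hwn y hy).symm
  have hftc := intervalIntegral.integral_eq_sub_of_hasDerivAt_of_le (a := -1) (b := 1)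
    (f := fun x : ℝ => w x / (A.Ξ x - z))
    (f' := fun x : ℝ => -((z ^ 2 - 1) * (deriv A.Ξ x / srp (A.Ξ x) / (A.Ξ x - z) ^ 2) +
      z * (deriv A.Ξ x / srp (A.Ξ x) / (A.Ξ x - z)))) (by norm_num)
    (hwc.div (A.continuousOn_Icc.sub continuousOn_const)
      fun x hx => A.sub_ne_zero_of_mem_compl hz hx)
    (fun x hx => by
      have h0 := A.sub_ne_zero_of_mem_compl hz (Ioo_subset_Icc_self hx)
      have hw := boundary_ne_zero hsrp hx
      have hsq := boundary_sq hsrp hx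
      have := (hwd x hx).fun_div ((A.hasDerivAt (Ioo_subset_Icc_self hx)).sub_const z) h0
      refine this.congr_deriv ?_
      have e : w x = srp (A.Ξ x) := indicator_of_mem hx _
      rw [e]
      field_simp
      rw [hsq]
      ring)
    (by
      rw [intervalIntegrable_iff_integrableOn_Ioo_of_le (by norm_num)]
      exact ((hi1.const_mul _).add (hi2.const_mul _)).neg)
  rw [intervalIntegral.integral_of_le (by norm_num), integral_Ioc_eq_integral_Ioo, integral_neg,
    integral_add (hi1.const_mul _) (hi2.const_mul _), integral_const_mul, integral_const_mul] at hftc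
  have h1 : w 1 = 0 := indicator_of_notMem (by simp) _
  have h2 : w (-1) = 0 := indicator_of_notMem (by simp) _
  rw [h1, h2, zero_div, zero_div, sub_zero, neg_eq_zero] at hftc
  exact hftc

theorem exists_mul_cauchy_eq_const : ∃ c : ℂ, ∀ z ∈ A.arcᶜ,
    S.sr z * (∫ x in Ioo (-1:ℝ) 1, deriv A.Ξ x / srp (A.Ξ x) / (A.Ξ x - z)) = c := by
  have key : ∀ z ∈ A.arcᶜ, HasDerivAt (fun z => S.sr z *
      (∫ x in Ioo (-1:ℝ) 1, deriv A.Ξ x / srp (A.Ξ x) / (A.Ξ x - z))) 0 z := by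
    intro z hz
    have hn := A.isOpen_compl_arc.mem_nhds hz
    have hsd : HasDerivAt S.sr (deriv S.sr z) z := (S.diff.differentiableAt hn).hasDerivAt
    have h1 : HasDerivAt (fun z => S.sr z ^ 2) (2 * S.sr z * deriv S.sr z) z := by
      simpa using hsd.fun_pow 2
    have h2 : HasDerivAt (fun z => S.sr z ^ 2) (2 * z) z := by
      have : HasDerivAt (fun z : ℂ => z ^ 2 - 1) (2 * z) z := by
        simpa using ((hasDerivAt_id z).fun_pow 2).sub_const 1
      refine this.congr_of_eventuallyEq ?_
      filter_upwards [hn] with y hy using S.sq y hy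
    have h3 := h1.unique h2
    refine (hsd.fun_mul (cauchy_hasDerivAt hsrp hz).2).congr_deriv ?_
    have h0 := S.ne_zero hz
    have hode := cauchy_ode hsrp hz
    rw [← S.sq z hz] at hode
    refine mul_left_cancel₀ h0 ?_
    rw [mul_zero]
    linear_combination hode + (1 / 2 : ℂ) * h3 *
      (∫ x in Ioo (-1:ℝ) 1, deriv A.Ξ x / srp (A.Ξ x) / (A.Ξ x - z))
  exact A.isOpen_compl_arc.exists_is_const_of_deriv_eq_zero A.isPreconnected_compl_arc
    (fun z hz => (key z hz).differentiableAt.differentiableWithinAt) (fun z hz => (key z hz).deriv)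

end SqrtBranch

theorem HasDerivAt.exists_norm_sub_le {E : Type*} [NormedAddCommGroup E] [NormedSpace ℝ E]
    {f : ℝ → E} {f' : E} {x : ℝ} (h : HasDerivAt f f' x) :
    ∃ C ≥ 0, ∀ᶠ y in 𝓝 x, ‖f y - f x‖ ≤ C * |y - x| := by
  obtain ⟨C, hC, hb⟩ := h.differentiableAt.isBigO_sub.exists_nonneg
  exact ⟨C, hC, by simpa using hb.bound⟩

/-- A second-order Taylor estimate, uniform in the two points. -/
theorem AnalyticAt.exists_norm_sub_sub_deriv_le {f : ℂ → ℂ} {c : ℂ} (hf : AnalyticAt ℂ f c) :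
    ∃ C ≥ 0, ∀ᶠ p : ℂ × ℂ in 𝓝 (c, c), ‖f p.1 - f p.2 - deriv f c * (p.1 - p.2)‖ ≤
      C * (max ‖p.1 - c‖ ‖p.2 - c‖ * ‖p.1 - p.2‖) := by
  obtain ⟨p, hp⟩ := hf
  obtain ⟨C, hC, h⟩ := hp.isBigO_image_sub_norm_mul_norm_sub.exists_nonneg
  refine ⟨C, hC, ?_⟩
  filter_upwards [h.bound] with y hy
  have e : (p 1 fun _ => y.1 - y.2) = deriv f c * (y.1 - y.2) := by
    rw [hp.deriv]
    have := p.apply_eq_pow_smul_coeff (n := 1) (z := y.1 - y.2)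
    rw [this]
    simp [mul_comm]
  rw [e] at hy
  refine hy.trans_eq ?_
  rw [norm_mul, norm_norm, norm_norm, Prod.norm_def]
  rfl

namespace SqrtBranch
variable {A : AnalyticArc} {S : SqrtBranch A} {srp : ℂ → ℂ} (hsrp : BVplus A.Ξ S.sr srp)

include hsrp

theorem density_hasDerivAt {x₀ : ℝ} (hx₀ : x₀ ∈ Ioo (-1:ℝ) 1) :
    ∃ d, HasDerivAt (fun x : ℝ => deriv A.Ξ x / srp (A.Ξ x)) d x₀ := by
  have h1 : HasDerivAt (fun x : ℝ => deriv A.Ξ x) (deriv (deriv A.Ξ) x₀) x₀ :=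
    ((A.analyticAt (A.ofReal_mem_U (Ioo_subset_Icc_self hx₀))).deriv.differentiableAt.hasDerivAt
      ).comp_ofReal
  exact ⟨_, h1.fun_div (boundary_hasDerivAt hsrp hx₀) (boundary_ne_zero hsrp hx₀)⟩

/-- The Cauchy kernel in the parameter minus its model singularity is dominated near a point of
the open arc, uniformly on the vertical segment through that point. -/
theorem exists_norm_cauchy_sub_le {x₀ : ℝ} (hx₀ : x₀ ∈ Ioo (-1:ℝ) 1) :
    ∃ C, ∀ᶠ y : ℝ in 𝓝 0, ∀ x ∈ Ioo (-1:ℝ) 1, x ≠ x₀ →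
      ‖deriv A.Ξ x / srp (A.Ξ x) / (A.Ξ x - A.Ξ (x₀ + y * I)) -
        (srp (A.Ξ x₀))⁻¹ / (x - (x₀ + y * I))‖ ≤ C * (1 + ‖deriv A.Ξ x / srp (A.Ξ x)‖) := by
  have hx₀' := Ioo_subset_Icc_self hx₀
  have hw := boundary_ne_zero hsrp hx₀
  obtain ⟨b, hb, hbd⟩ := A.exists_le_norm_sub hx₀'
  obtain ⟨K, hK, hT⟩ := (A.analyticAt (A.ofReal_mem_U hx₀')).exists_norm_sub_sub_deriv_le
  obtain ⟨d, hd⟩ := density_hasDerivAt hsrp hx₀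
  obtain ⟨G, hG, hg⟩ := hd.exists_norm_sub_le
  set w := srp (A.Ξ x₀)
  rw [nhds_prod_eq] at hT
  obtain ⟨V, hV, hT⟩ := eventually_prod_self_iff'.1 hT
  obtain ⟨η₁, hη₁, hVs⟩ := Metric.mem_nhds_iff.1 hV
  obtain ⟨η₂, hη₂, hg⟩ := Metric.eventually_nhds_iff.1 hg
  set η := min η₁ η₂
  have hη : 0 < η := lt_min hη₁ hη₂
  have hwn : 0 < ‖w‖ := norm_pos_iff.2 hw
  set C₁ := (G + ‖w‖⁻¹ * K) / b
  set C₂ := (b * η)⁻¹ + ‖w‖⁻¹ * η⁻¹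
  have hC₁ : 0 ≤ C₁ := by positivity
  have hC₂ : 0 ≤ C₂ := by positivity
  refine ⟨C₁ + C₂, ?_⟩
  have ht := AnalyticArc.tendsto_vertical x₀
  filter_upwards [ht.eventually hbd, ht.eventually (ball_mem_nhds (x₀:ℂ) hη)] with y hby hyη x hx hxx
  set ζ : ℂ := x₀ + y * I
  set g := deriv A.Ξ x / srp (A.Ξ x)
  have hgn := norm_nonneg g
  have hbx := hby x (Ioo_subset_Icc_self hx)
  have e1 : |x - x₀| ≤ ‖(x:ℂ) - ζ‖ := by
    refine le_trans (le_of_eq ?_) (Complex.abs_re_le_norm _)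
    simp [ζ]
  have e2 : ‖ζ - x₀‖ ≤ ‖(x:ℂ) - ζ‖ := by
    have := Complex.abs_im_le_norm ((x:ℂ) - ζ)
    simpa [ζ] using this
  have e3 : 0 < ‖(x:ℂ) - ζ‖ := (abs_pos.2 (sub_ne_zero.2 hxx)).trans_le e1
  have e4 : 0 < ‖A.Ξ x - A.Ξ ζ‖ := (mul_pos hb e3).trans_le hbx
  have h3 : (x:ℂ) - ζ ≠ 0 := norm_pos_iff.1 e3
  have h4 : A.Ξ x - A.Ξ ζ ≠ 0 := norm_pos_iff.1 e4
  by_cases hxη : |x - x₀| < η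
  · have t1 : ‖A.Ξ x - A.Ξ ζ - deriv A.Ξ x₀ * (x - ζ)‖ ≤ K * (‖(x:ℂ) - ζ‖ * ‖(x:ℂ) - ζ‖) := by
      refine (hT x (hVs ?_) ζ (hVs ?_)).trans ?_
      · rw [mem_ball, dist_eq_norm, ← ofReal_sub, norm_real]
        exact hxη.trans_le (min_le_left _ _)
      · exact ball_subset_ball (min_le_left _ _) hyη
      · have : max ‖(x:ℂ) - x₀‖ ‖ζ - x₀‖ ≤ ‖(x:ℂ) - ζ‖ :=
          max_le (by rwa [← ofReal_sub, norm_real]) e2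
        dsimp only
        gcongr
    have t2 : ‖g - deriv A.Ξ x₀ / w‖ ≤ G * ‖(x:ℂ) - ζ‖ :=
      (hg (hxη.trans_le (min_le_right _ _))).trans (by gcongr)
    have e : g / (A.Ξ x - A.Ξ ζ) - w⁻¹ / (x - ζ) =
        ((g - deriv A.Ξ x₀ / w) * (x - ζ) -
          w⁻¹ * (A.Ξ x - A.Ξ ζ - deriv A.Ξ x₀ * (x - ζ))) / ((A.Ξ x - A.Ξ ζ) * (x - ζ)) := by
      field_simp
      ring
    have hC : ‖g / (A.Ξ x - A.Ξ ζ) - w⁻¹ / (x - ζ)‖ ≤ C₁ := by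
      rw [e, norm_div, norm_mul, div_le_iff₀ (mul_pos e4 e3)]
      calc _ ≤ G * ‖(x:ℂ) - ζ‖ * ‖(x:ℂ) - ζ‖ +
            ‖w‖⁻¹ * (K * (‖(x:ℂ) - ζ‖ * ‖(x:ℂ) - ζ‖)) := by
            refine (norm_sub_le _ _).trans ?_
            rw [norm_mul, norm_mul, norm_inv]
            gcongr
        _ = C₁ * (b * ‖(x:ℂ) - ζ‖ * ‖(x:ℂ) - ζ‖) := by
            simp only [C₁]
            field_simp
        _ ≤ _ := by gcongr
    nlinarith [mul_nonneg hC₁ hgn, mul_nonneg hC₂ hgn]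
  · rw [not_lt] at hxη
    have f1 : ‖g / (A.Ξ x - A.Ξ ζ)‖ ≤ (b * η)⁻¹ * ‖g‖ := by
      rw [norm_div, div_eq_inv_mul]
      have : b * η ≤ ‖A.Ξ x - A.Ξ ζ‖ := hbx.trans' (by gcongr; exact hxη.trans e1)
      gcongr
    have f2 : ‖w⁻¹ / (x - ζ)‖ ≤ ‖w‖⁻¹ * η⁻¹ := by
      rw [norm_div, norm_inv, div_eq_mul_inv]
      gcongr
      exact hxη.trans e1
    have f3 : 0 ≤ (b * η)⁻¹ := by positivity
    have f4 : 0 ≤ ‖w‖⁻¹ * η⁻¹ := by positivity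
    refine (norm_sub_le _ _).trans ((add_le_add f1 f2).trans ?_)
    simp only [C₂]
    nlinarith [mul_nonneg hC₁ hgn, mul_nonneg f4 hgn]

end SqrtBranch

/-- Principal value of `1/(x - x₀)` on `[-1,1]`, truncated by a comparable gauge `n`. -/
theorem tendsto_integral_inv_truncated {x₀ : ℝ} (hx₀ : x₀ ∈ Ioo (-1:ℝ) 1) {n : ℝ → ℝ}
    (hn : ContinuousOn n (Icc (-1) 1)) {a b : ℝ} (ha : 0 < a) (hb : 0 < b)
    (hbn : ∀ x ∈ Icc (-1:ℝ) 1, b * |x - x₀| ≤ n x) (hn0 : n x₀ = 0)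
    (hna : Tendsto (fun x => n x / |x - x₀|) (𝓝[≠] x₀) (𝓝 a)) :
    Tendsto (fun ε : ℝ => ∫ x in {x ∈ Icc (-1:ℝ) 1 | ε ≤ n x}, (x - x₀)⁻¹) (𝓝[>] 0)
      (𝓝 (Real.log (1 - x₀) - Real.log (1 + x₀))) := by
  set T : ℝ → Set ℝ := fun ε => {x ∈ Icc (-1:ℝ) 1 | ε ≤ n x}
  have hTc : ∀ ε, IsCompact (T ε) := fun ε =>
    isCompact_Icc.of_isClosed_subset (hn.preimage_isClosed_of_isClosed isClosed_Icc isClosed_Ici)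
      fun x hx => hx.1
  have hTm : ∀ ε, MeasurableSet (T ε) := fun ε => (hTc ε).isClosed.measurableSet
  set f : ℝ → ℝ → ℝ := fun ε => (T ε).indicator fun x => (x - x₀)⁻¹
  have hfi : ∀ ε > 0, Integrable (f ε) := by
    intro ε hε
    refine IntegrableOn.integrable_indicator ?_ (hTm ε)
    refine ContinuousOn.integrableOn_compact (hTc ε) ?_
    refine ContinuousOn.inv₀ (by fun_prop) fun x hx h => ?_
    rw [sub_eq_zero.1 h] at hx
    have := hx.2
    rw [hn0] at this
    linarith
  set K := b⁻¹
  have hK : 0 < K := inv_pos.2 hb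
  set m : ℝ → ℝ → ℝ := fun ε s => if ε * s + x₀ ∈ T ε then s⁻¹ else 0
  have hsplit : ∀ᶠ ε in 𝓝[>] (0:ℝ), ∫ x in T ε, (x - x₀)⁻¹ =
      (Real.log (1 - x₀) - Real.log (1 + x₀)) + ∫ s in (-K)..K, m ε s := by
    have h1 : ∀ᶠ ε in 𝓝[>] (0:ℝ), K * ε < min (1 - x₀) (1 + x₀) := by
      have : Tendsto (fun ε : ℝ => K * ε) (𝓝 0) (𝓝 0) := by
        simpa using (tendsto_id (α := ℝ) (x := 𝓝 0)).const_mul K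
      exact (this.eventually_lt_const (lt_min (by linarith [hx₀.2]) (by linarith [hx₀.1]))).filter_mono
        nhdsWithin_le_nhds
    filter_upwards [h1, self_mem_nhdsWithin] with ε hε hε0
    have hε0 : 0 < ε := hε0
    have hKε : 0 < K * ε := by positivity
    obtain ⟨hε1, hε2⟩ := lt_min_iff.1 hε
    have hii : ∀ p q, IntervalIntegrable (f ε) volume p q := fun p q =>
      (hfi ε hε0).intervalIntegrable
    have e0 : ∫ x in T ε, (x - x₀)⁻¹ = ∫ x in (-1:ℝ)..1, f ε x := by
      rw [intervalIntegral.integral_of_le (by norm_num), ← integral_Icc_eq_integral_Ioc,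
        setIntegral_indicator (hTm ε), inter_eq_self_of_subset_right fun x hx => hx.1]
    have hbK : ∀ x ∈ Icc (-1:ℝ) 1, K * ε ≤ |x - x₀| → f ε x = (x - x₀)⁻¹ := by
      intro x hx h
      refine indicator_of_mem (s := T ε) ⟨hx, ?_⟩ _
      refine le_trans ?_ (hbn x hx)
      calc ε = b * (K * ε) := by simp only [K]; field_simp
        _ ≤ _ := by gcongr
    have e1 : ∫ x in (-1:ℝ)..(ε * (-K) + x₀), f ε x = Real.log (K * ε) - Real.log (1 + x₀) := by
      rw [intervalIntegral.integral_congr (g := fun x => (x - x₀)⁻¹),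
        intervalIntegral.integral_comp_sub_right (fun x => x⁻¹) x₀, integral_inv,
        ← Real.log_div (by positivity) (by linarith)]
      · congr 1
        rw [show ε * -K + x₀ - x₀ = -(K * ε) by ring, show -1 - x₀ = -(1 + x₀) by ring, neg_div_neg_eq]
      · rw [uIcc_of_le (by linarith)]
        intro h
        have := h.2
        linarith
      · intro x hx
        rw [uIcc_of_le (by linarith)] at hx
        refine hbK x ⟨hx.1, by linarith [hx.2]⟩ ?_
        rw [abs_sub_comm]
        refine le_trans ?_ (le_abs_self _)
        linarith [hx.2]
    have e3 : ∫ x in (ε * K + x₀)..1, f ε x = Real.log (1 - x₀) - Real.log (K * ε) := by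
      rw [intervalIntegral.integral_congr (g := fun x => (x - x₀)⁻¹),
        intervalIntegral.integral_comp_sub_right (fun x => x⁻¹) x₀, integral_inv,
        ← Real.log_div (by linarith) (by positivity)]
      · congr 1
        rw [show ε * K + x₀ - x₀ = K * ε by ring]
      · rw [uIcc_of_le (by linarith)]
        intro h
        have := h.1
        linarith
      · intro x hx
        rw [uIcc_of_le (by linarith)] at hx
        refine hbK x ⟨by linarith [hx.1], hx.2⟩ ?_
        refine le_trans ?_ (le_abs_self _)
        linarith [hx.1]
    have e2 : ∫ x in (ε * (-K) + x₀)..(ε * K + x₀), f ε x = ∫ s in (-K)..K, m ε s := by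
      have h := intervalIntegral.integral_comp_mul_add (a := -K) (b := K) (f ε) hε0.ne' x₀
      rw [smul_eq_mul, eq_inv_mul_iff_mul_eq₀ hε0.ne'] at h
      rw [← h, ← intervalIntegral.integral_const_mul]
      refine intervalIntegral.integral_congr fun s _ => ?_
      simp only [f, m, indicator_apply]
      split_ifs
      · rw [add_sub_cancel_right, mul_inv]; field_simp
      · simp
    rw [e0, ← intervalIntegral.integral_add_adjacent_intervals (hii _ (ε * (-K) + x₀)) (hii _ _),
      ← intervalIntegral.integral_add_adjacent_intervals (hii (ε * (-K) + x₀) (ε * K + x₀)) (hii _ _),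
      e1, e2, e3]
    ring
  set m₀ : ℝ → ℝ := fun s => if 1 < a * |s| then s⁻¹ else 0
  have hm₀ : ∫ s in (-K)..K, m₀ s = 0 := by
    have h := intervalIntegral.integral_comp_neg (a := -K) (b := K) m₀
    have h2 : ∀ s, m₀ (-s) = - m₀ s := by
      intro s
      simp only [m₀, abs_neg]
      split_ifs <;> simp
    simp only [h2, intervalIntegral.integral_neg, neg_neg] at h
    linarith
  have hscale : ∀ s : ℝ, Tendsto (fun ε : ℝ => ε * s + x₀) (𝓝[>] 0) (𝓝 x₀) := by
    intro s
    have : Continuous fun ε : ℝ => ε * s + x₀ := by fun_prop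
    simpa using (this.tendsto 0).mono_left nhdsWithin_le_nhds
  have hlim : Tendsto (fun ε => ∫ s in (-K)..K, m ε s) (𝓝[>] 0) (𝓝 (∫ s in (-K)..K, m₀ s)) := by
    refine intervalIntegral.tendsto_integral_filter_of_dominated_convergence (fun _ => 2 * a)
      ?_ ?_ intervalIntegrable_const ?_
    · refine Eventually.of_forall fun ε => Measurable.aestronglyMeasurable ?_
      exact Measurable.ite ((hTm ε).preimage (by fun_prop)) measurable_inv measurable_const
    · have h1 : ∀ᶠ x in 𝓝[≠] x₀, n x / |x - x₀| < 2 * a := hna.eventually_lt_const (by linarith)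
      rw [eventually_nhdsWithin_iff, Metric.eventually_nhds_iff] at h1
      obtain ⟨η, hη, h1⟩ := h1
      have h2 : ∀ᶠ ε in 𝓝[>] (0:ℝ), ε * K < η := by
        have : Tendsto (fun ε : ℝ => ε * K) (𝓝 0) (𝓝 0) := by
          simpa using (tendsto_id (α := ℝ) (x := 𝓝 0)).mul_const K
        exact (this.eventually_lt_const hη).filter_mono nhdsWithin_le_nhds
      filter_upwards [h2, self_mem_nhdsWithin] with ε hε hε0
      have hε0 : 0 < ε := hε0
      refine Eventually.of_forall fun s hs => ?_
      rw [uIoc_of_le (by linarith)] at hs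
      simp only [m]
      split_ifs with hsT
      · have hs0 : s ≠ 0 := by
          rintro rfl
          have := hsT.2
          rw [mul_zero, zero_add, hn0] at this
          linarith
        have hsa : |s| ≤ K := abs_le.2 ⟨hs.1.le, hs.2⟩
        have e : |ε * s + x₀ - x₀| = ε * |s| := by
          rw [add_sub_cancel_right, abs_mul, abs_of_pos hε0]
        have hp : 0 < |s| := abs_pos.2 hs0
        have := h1 (y := ε * s + x₀) (by
          rw [Real.dist_eq, e]
          exact (mul_le_mul_of_nonneg_left hsa hε0.le).trans_lt hε)
          (by simp [hs0, hε0.ne'])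
        rw [e, div_lt_iff₀ (by positivity)] at this
        have h3 := hsT.2.trans_lt this
        rw [Real.norm_eq_abs, abs_inv, inv_le_iff_one_le_mul₀ hp]
        by_contra! h4
        nlinarith
      · simpa using ha.le
    · have hae : ∀ᵐ s : ℝ, a * |s| ≠ 1 := by
        have : {s : ℝ | ¬ a * |s| ≠ 1} ⊆ {a⁻¹, -a⁻¹} := by
          intro s hs
          simp only [ne_eq, not_not, Set.mem_ofPred_eq] at hs
          have : |s| = a⁻¹ := by field_simp; linarith
          rcases abs_choice s with h | h
          · left; linarith
          · right; simp only [Set.mem_singleton_iff]; linarith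
        exact measure_mono_null this ((Set.toFinite _).measure_zero _)
      filter_upwards [hae] with s hs _
      by_cases hs0 : s = 0
      · subst hs0; simp [m, m₀]
      have hp : 0 < |s| := abs_pos.2 hs0
      have h1 : Tendsto (fun ε : ℝ => ε * s + x₀) (𝓝[>] 0) (𝓝[≠] x₀) := by
        refine tendsto_nhdsWithin_iff.2 ⟨hscale s, ?_⟩
        filter_upwards [self_mem_nhdsWithin] with ε hε
        have hε : 0 < ε := hε
        simp [hs0, hε.ne']
      have h2 : Tendsto (fun ε : ℝ => n (ε * s + x₀) / ε) (𝓝[>] 0) (𝓝 (a * |s|)) := by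
        refine ((hna.comp h1).mul_const |s|).congr' ?_
        filter_upwards [self_mem_nhdsWithin] with ε hε
        have hε : 0 < ε := hε
        simp only [Function.comp_apply, add_sub_cancel_right, abs_mul, abs_of_pos hε]
        field_simp
      have h3 : ∀ᶠ ε : ℝ in 𝓝[>] 0, ε * s + x₀ ∈ Icc (-1:ℝ) 1 :=
        (hscale s).eventually (Icc_mem_nhds hx₀.1 hx₀.2)
      refine tendsto_const_nhds.congr' ?_
      rcases lt_or_gt_of_ne hs with h | h
      · filter_upwards [h2.eventually_lt_const h, self_mem_nhdsWithin] with ε hε hε0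
        have hε0 : 0 < ε := hε0
        rw [div_lt_one hε0] at hε
        simp [m, m₀, h.not_gt, T, hε.not_ge]
      · filter_upwards [h2.eventually_const_lt h, h3, self_mem_nhdsWithin] with ε hε hI hε0
        have hε0 : 0 < ε := hε0
        rw [one_lt_div hε0] at hε
        have : ε * s + x₀ ∈ T ε := ⟨hI, hε.le⟩
        simp [m, m₀, h, this]
  have := (tendsto_const_nhds (x := Real.log (1 - x₀) - Real.log (1 + x₀))).add hlim
  rw [hm₀, add_zero] at this
  exact this.congr' (hsplit.mono fun ε h => h.symm)

theorem isCompact_truncation {n : ℝ → ℝ} (hn : ContinuousOn n (Icc (-1) 1)) (ε : ℝ) :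
    IsCompact {x ∈ Icc (-1:ℝ) 1 | ε ≤ n x} :=
  isCompact_Icc.of_isClosed_subset (hn.preimage_isClosed_of_isClosed isClosed_Icc isClosed_Ici)
    fun _ hx => hx.1

theorem tendsto_setIntegral_truncation {x₀ : ℝ} {n : ℝ → ℝ} (hn : ContinuousOn n (Icc (-1) 1))
    (hpos : ∀ x ∈ Icc (-1:ℝ) 1, x ≠ x₀ → 0 < n x) {h : ℝ → ℂ} (hh : IntegrableOn h (Ioo (-1) 1)) :
    Tendsto (fun ε => ∫ x in {x ∈ Icc (-1:ℝ) 1 | ε ≤ n x}, h x) (𝓝[>] 0)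
      (𝓝 (∫ x in Ioo (-1:ℝ) 1, h x)) := by
  rw [← integrableOn_Icc_iff_integrableOn_Ioo] at hh
  rw [← integral_Icc_eq_integral_Ioo]
  have e : ∀ ε, ∫ x in {x ∈ Icc (-1:ℝ) 1 | ε ≤ n x}, h x =
      ∫ x in Icc (-1:ℝ) 1, {x ∈ Icc (-1:ℝ) 1 | ε ≤ n x}.indicator h x := fun ε => by
    rw [setIntegral_indicator (isCompact_truncation hn ε).measurableSet]
    congr 2
    ext x
    simp
  simp only [e]
  refine tendsto_integral_filter_of_dominated_convergence (fun x => ‖h x‖) ?_ ?_ hh.norm ?_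
  · exact Eventually.of_forall fun ε => hh.aestronglyMeasurable.indicator
      (isCompact_truncation hn ε).measurableSet
  · exact Eventually.of_forall fun ε => Eventually.of_forall fun x => norm_indicator_le_norm_self _ _
  · have : ∀ᵐ x : ℝ ∂volume.restrict (Icc (-1:ℝ) 1), x ≠ x₀ := Measure.ae_ne _ _
    filter_upwards [ae_restrict_mem measurableSet_Icc, this] with x hx hxx
    refine tendsto_const_nhds.congr' ?_
    filter_upwards [Ioo_mem_nhdsGT (hpos x hx hxx)] with ε hε
    rw [indicator_of_mem]
    exact ⟨hx, hε.2.le⟩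

theorem sub_mem_slitPlane {x₀ y : ℝ} (hy : y ≠ 0) (x : ℝ) :
    (x:ℂ) - (x₀ + y * I) ∈ slitPlane := by
  right
  simpa using hy

theorem integrableOn_inv_sub {x₀ y : ℝ} (hy : y ≠ 0) :
    IntegrableOn (fun x : ℝ => ((x:ℂ) - (x₀ + y * I))⁻¹) (Ioo (-1) 1) := by
  refine IntegrableOn.mono_set (t := Icc (-1) 1) (ContinuousOn.integrableOn_Icc ?_)
    Ioo_subset_Icc_self
  refine ContinuousOn.inv₀ (by fun_prop) fun x _ => slitPlane_ne_zero (sub_mem_slitPlane hy x)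

theorem integral_inv_sub {x₀ y : ℝ} (hy : y ≠ 0) :
    ∫ x in Ioo (-1:ℝ) 1, ((x:ℂ) - (x₀ + y * I))⁻¹ =
      log (1 - (x₀ + y * I)) - log (-1 - (x₀ + y * I)) := by
  have := intervalIntegral.integral_eq_sub_of_hasDerivAt (a := -1) (b := 1)
    (f := fun x : ℝ => log ((x:ℂ) - (x₀ + y * I)))
    (f' := fun x : ℝ => ((x:ℂ) - (x₀ + y * I))⁻¹)
    (fun x _ => by
      have h : HasDerivAt (fun x : ℝ => (x:ℂ) - (x₀ + y * I)) 1 x :=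
        (hasDerivAt_id x).ofReal_comp.sub_const _
      simpa using h.clog_real (sub_mem_slitPlane hy x))
    (by
      rw [intervalIntegrable_iff_integrableOn_Ioo_of_le (by norm_num)]
      exact integrableOn_inv_sub hy)
  rw [← integral_Ioc_eq_integral_Ioo, ← intervalIntegral.integral_of_le (by norm_num), this]
  simp

theorem tendsto_log_one_sub {x₀ : ℝ} (hx₀ : x₀ ∈ Ioo (-1:ℝ) 1) :
    Tendsto (fun y : ℝ => log (1 - (x₀ + y * I))) (𝓝 0) (𝓝 (Real.log (1 - x₀))) := by
  have h : (1 - (x₀:ℂ)) ∈ slitPlane := by left; simpa using hx₀.2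
  have := ((tendsto_const_nhds (x := (1:ℂ))).sub (AnalyticArc.tendsto_vertical x₀)).clog h
  convert this using 2
  rw [← ofReal_one, ← ofReal_sub, ofReal_log]
  linarith [hx₀.2]

theorem tendsto_log_neg_one_sub_left {x₀ : ℝ} (hx₀ : x₀ ∈ Ioo (-1:ℝ) 1) :
    Tendsto (fun y : ℝ => log (-1 - (x₀ + y * I))) (𝓝[>] 0)
      (𝓝 (Real.log (1 + x₀) - Real.pi * I)) := by
  have h := tendsto_log_nhdsWithin_im_neg_of_re_neg_of_im_zero (z := -1 - (x₀:ℂ))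
    (by simp; linarith [hx₀.1]) (by simp)
  have e : ‖-1 - (x₀:ℂ)‖ = 1 + x₀ := by
    rw [← ofReal_one, ← ofReal_neg, ← ofReal_sub, norm_real, Real.norm_eq_abs, abs_of_neg] <;>
      linarith [hx₀.1]
  rw [e] at h
  refine h.comp (tendsto_nhdsWithin_iff.2 ⟨?_, ?_⟩)
  · exact ((tendsto_const_nhds (x := (-1:ℂ))).sub (AnalyticArc.tendsto_vertical x₀)).mono_left
      nhdsWithin_le_nhds
  · filter_upwards [self_mem_nhdsWithin] with y hy
    simpa using hy

theorem tendsto_log_neg_one_sub_right {x₀ : ℝ} (hx₀ : x₀ ∈ Ioo (-1:ℝ) 1) :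
    Tendsto (fun y : ℝ => log (-1 - (x₀ + y * I))) (𝓝[<] 0)
      (𝓝 (Real.log (1 + x₀) + Real.pi * I)) := by
  have h := tendsto_log_nhdsWithin_im_nonneg_of_re_neg_of_im_zero (z := -1 - (x₀:ℂ))
    (by simp; linarith [hx₀.1]) (by simp)
  have e : ‖-1 - (x₀:ℂ)‖ = 1 + x₀ := by
    rw [← ofReal_one, ← ofReal_neg, ← ofReal_sub, norm_real, Real.norm_eq_abs, abs_of_neg] <;>
      linarith [hx₀.1]
  rw [e] at h
  refine h.comp (tendsto_nhdsWithin_iff.2 ⟨?_, ?_⟩)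
  · exact ((tendsto_const_nhds (x := (-1:ℂ))).sub (AnalyticArc.tendsto_vertical x₀)).mono_left
      nhdsWithin_le_nhds
  · filter_upwards [self_mem_nhdsWithin] with y hy
    simpa using le_of_lt hy

namespace SqrtBranch
variable {A : AnalyticArc} {S : SqrtBranch A} {srp : ℂ → ℂ} (hsrp : BVplus A.Ξ S.sr srp)
include hsrp

theorem tendsto_integral_remainder {x₀ : ℝ} (hx₀ : x₀ ∈ Ioo (-1:ℝ) 1) :
    IntegrableOn (fun x : ℝ => deriv A.Ξ x / srp (A.Ξ x) / (A.Ξ x - A.Ξ x₀) -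
      (srp (A.Ξ x₀))⁻¹ / (x - x₀)) (Ioo (-1) 1) ∧
    Tendsto (fun y : ℝ => ∫ x in Ioo (-1:ℝ) 1,
        (deriv A.Ξ x / srp (A.Ξ x) / (A.Ξ x - A.Ξ (x₀ + y * I)) -
          (srp (A.Ξ x₀))⁻¹ / (x - (x₀ + y * I)))) (𝓝 0)
      (𝓝 (∫ x in Ioo (-1:ℝ) 1, (deriv A.Ξ x / srp (A.Ξ x) / (A.Ξ x - A.Ξ x₀) -
          (srp (A.Ξ x₀))⁻¹ / (x - x₀)))) := by
  obtain ⟨C, hC⟩ := exists_norm_cauchy_sub_le hsrp hx₀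
  have hm : ∀ ζ : ℂ, AEStronglyMeasurable (fun x : ℝ => deriv A.Ξ x / srp (A.Ξ x) /
      (A.Ξ x - A.Ξ ζ) - (srp (A.Ξ x₀))⁻¹ / (x - ζ)) (volume.restrict (Ioo (-1) 1)) := fun ζ =>
    (((density_aemeasurable hsrp).div
      (A.aestronglyMeasurable_Ioo.aemeasurable.sub aemeasurable_const)).sub
      (by fun_prop)).aestronglyMeasurable
  have hg := density_integrableOn hsrp
  have hbi : IntegrableOn (fun x : ℝ => C * (1 + ‖deriv A.Ξ x / srp (A.Ξ x)‖)) (Ioo (-1) 1) :=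
    ((integrableOn_const (by simp)).add hg.norm).const_mul C
  have hne : ∀ᵐ x : ℝ ∂volume.restrict (Ioo (-1:ℝ) 1), x ≠ x₀ := Measure.ae_ne _ _
  constructor
  · refine hbi.mono' (hm x₀) ?_
    filter_upwards [ae_restrict_mem measurableSet_Ioo, hne] with x hx hxx
    simpa using hC.self_of_nhds x hx hxx
  · refine tendsto_integral_filter_of_dominated_convergence _
      (Eventually.of_forall fun y => hm _) ?_ hbi ?_
    · filter_upwards [hC] with y hy
      filter_upwards [ae_restrict_mem measurableSet_Ioo, hne] with x hx hxx using hy x hx hxx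
    · filter_upwards [ae_restrict_mem measurableSet_Ioo, hne] with x hx hxx
      have h1 := AnalyticArc.tendsto_vertical x₀
      have h2 := (A.continuousAt_Ξ (Ioo_subset_Icc_self hx₀)).tendsto.comp h1
      refine (tendsto_const_nhds.div (tendsto_const_nhds.sub h2) ?_).sub
        (tendsto_const_nhds.div (tendsto_const_nhds.sub h1) ?_)
      · refine sub_ne_zero.2 fun h => hxx ?_
        exact A.Ξ_ofReal_inj (Ioo_subset_Icc_self hx) (Ioo_subset_Icc_self hx₀) h
      · rw [← ofReal_sub, ofReal_ne_zero]
        exact sub_ne_zero.2 hxx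

theorem eventually_cauchy_eq {x₀ : ℝ} (hx₀ : x₀ ∈ Ioo (-1:ℝ) 1) : ∀ᶠ y : ℝ in 𝓝[≠] 0,
    ∫ x in Ioo (-1:ℝ) 1, deriv A.Ξ x / srp (A.Ξ x) / (A.Ξ x - A.Ξ (x₀ + y * I)) =
      (∫ x in Ioo (-1:ℝ) 1, (deriv A.Ξ x / srp (A.Ξ x) / (A.Ξ x - A.Ξ (x₀ + y * I)) -
          (srp (A.Ξ x₀))⁻¹ / (x - (x₀ + y * I)))) +
        (srp (A.Ξ x₀))⁻¹ * (log (1 - (x₀ + y * I)) - log (-1 - (x₀ + y * I))) := by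
  filter_upwards [A.eventually_mem_compl_arc (Ioo_subset_Icc_self hx₀), self_mem_nhdsWithin]
    with y hy hy0
  simp only [div_eq_mul_inv (srp (A.Ξ x₀))⁻¹]
  rw [integral_sub (cauchy_integrableOn hsrp hy) ((integrableOn_inv_sub hy0).const_mul _),
    integral_const_mul, integral_inv_sub hy0]
  ring

/-- The regularized singular integral vanishes, and so the constant in the Cauchy integral is
determined. -/
theorem remainder_add_log_eq_zero {x₀ : ℝ} (hx₀ : x₀ ∈ Ioo (-1:ℝ) 1) :
    (∫ x in Ioo (-1:ℝ) 1, (deriv A.Ξ x / srp (A.Ξ x) / (A.Ξ x - A.Ξ x₀) -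
        (srp (A.Ξ x₀))⁻¹ / (x - x₀))) +
      (srp (A.Ξ x₀))⁻¹ * (Real.log (1 - x₀) - Real.log (1 + x₀)) = 0 ∧
    ∀ z ∈ A.arcᶜ, S.sr z *
      (∫ x in Ioo (-1:ℝ) 1, deriv A.Ξ x / srp (A.Ξ x) / (A.Ξ x - z)) = Real.pi * I := by
  obtain ⟨c, hc⟩ := exists_mul_cauchy_eq_const hsrp
  have hx₀' := Ioo_subset_Icc_self hx₀
  have hw := boundary_ne_zero hsrp hx₀
  have hsq := boundary_sq hsrp hx₀
  obtain ⟨-, hR⟩ := tendsto_integral_remainder hsrp hx₀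
  have hev := eventually_cauchy_eq hsrp hx₀
  have hmem := A.eventually_mem_compl_arc hx₀'
  have hlt : 𝓝[<] (0:ℝ) ≤ 𝓝[≠] 0 := nhdsWithin_mono _ fun _ h => ne_of_lt h
  have hgt : 𝓝[>] (0:ℝ) ≤ 𝓝[≠] 0 := nhdsWithin_mono _ fun _ h => ne_of_gt h
  set R := ∫ x in Ioo (-1:ℝ) 1, (deriv A.Ξ x / srp (A.Ξ x) / (A.Ξ x - A.Ξ x₀) -
        (srp (A.Ξ x₀))⁻¹ / (x - x₀))
  set w := srp (A.Ξ x₀)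
  set p : ℂ := ((Real.log (1 - x₀) : ℝ) : ℂ)
  set q : ℂ := ((Real.log (1 + x₀) : ℝ) : ℂ)
  set F : ℝ → ℂ := fun y =>
    ∫ x in Ioo (-1:ℝ) 1, deriv A.Ξ x / srp (A.Ξ x) / (A.Ξ x - A.Ξ (x₀ + y * I))
  have hplus : Tendsto F (𝓝[>] 0) (𝓝 (R + w⁻¹ * (p - (q - Real.pi * I)))) :=
    ((hR.mono_left nhdsWithin_le_nhds).add ((((tendsto_log_one_sub hx₀).mono_left
      nhdsWithin_le_nhds).sub (tendsto_log_neg_one_sub_left hx₀)).const_mul _)).congr'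
      ((hev.filter_mono hgt).mono fun y h => h.symm)
  have hminus : Tendsto F (𝓝[<] 0) (𝓝 (R + w⁻¹ * (p - (q + Real.pi * I)))) :=
    ((hR.mono_left nhdsWithin_le_nhds).add ((((tendsto_log_one_sub hx₀).mono_left
      nhdsWithin_le_nhds).sub (tendsto_log_neg_one_sub_right hx₀)).const_mul _)).congr'
      ((hev.filter_mono hlt).mono fun y h => h.symm)
  have hΞ : Tendsto (fun y : ℝ => A.Ξ (x₀ + y * I) ^ 2 - 1) (𝓝 0) (𝓝 (w ^ 2)) := by
    rw [hsq]
    exact (((A.continuousAt_Ξ hx₀').tendsto.comp (AnalyticArc.tendsto_vertical x₀)).pow 2).sub_const 1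
  have hF : ∀ᶠ y : ℝ in 𝓝[≠] 0, (A.Ξ (x₀ + y * I) ^ 2 - 1) * F y ^ 2 = c ^ 2 := by
    filter_upwards [hmem] with y hy
    rw [← S.sq _ hy, ← mul_pow, hc _ hy]
  have h1 := tendsto_nhds_unique
    (((hΞ.mono_left nhdsWithin_le_nhds).mul (hplus.pow 2)).congr' (hF.filter_mono hgt))
    tendsto_const_nhds
  have h2 := tendsto_nhds_unique
    (((hΞ.mono_left nhdsWithin_le_nhds).mul (hminus.pow 2)).congr' (hF.filter_mono hlt))
    tendsto_const_nhds
  have h3 : w * (R + w⁻¹ * (p - (q - Real.pi * I))) = c :=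
    tendsto_nhds_unique (((hsrp x₀ hx₀).mul hplus).congr'
      ((hmem.filter_mono hgt).mono fun y hy => hc _ hy)) tendsto_const_nhds
  have hpi : (Real.pi : ℂ) * I ≠ 0 := mul_ne_zero (ofReal_ne_zero.2 Real.pi_ne_zero) I_ne_zero
  have h4 : R + w⁻¹ * (p - q) = 0 := by
    have h5 : 4 * w * (Real.pi * I) * (R + w⁻¹ * (p - q)) = 0 := by
      have e := h1.trans h2.symm
      field_simp at e ⊢
      linear_combination e
    exact (mul_eq_zero.1 h5).resolve_left (by simp [hw, hpi])
  refine ⟨h4, fun z hz => ?_⟩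
  rw [hc z hz, ← h3]
  field_simp at h4 ⊢
  linear_combination h4

theorem integral_cauchy {z : ℂ} (hz : z ∈ A.arcᶜ) :
    ∫ x in Ioo (-1:ℝ) 1, deriv A.Ξ x / srp (A.Ξ x) / (A.Ξ x - z) = Real.pi * I / S.sr z := by
  rw [eq_div_iff (S.ne_zero hz), mul_comm]
  exact (remainder_add_log_eq_zero hsrp (x₀ := 0) (by norm_num)).2 z hz

end SqrtBranch

namespace AnalyticArc
variable (A : AnalyticArc)

theorem norm_sub_continuousOn (τ : ℂ) :
    ContinuousOn (fun x : ℝ => ‖A.Ξ x - τ‖) (Icc (-1) 1) :=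
  (A.continuousOn_Icc.sub continuousOn_const).norm

theorem norm_sub_pos {x₀ : ℝ} (hx₀ : x₀ ∈ Icc (-1:ℝ) 1) :
    ∀ x ∈ Icc (-1:ℝ) 1, x ≠ x₀ → 0 < ‖A.Ξ x - A.Ξ x₀‖ := fun _ hx hxx =>
  norm_pos_iff.2 (sub_ne_zero.2 fun h => hxx (A.Ξ_ofReal_inj hx hx₀ h))

theorem tendsto_integral_inv_truncated {x₀ : ℝ} (hx₀ : x₀ ∈ Ioo (-1:ℝ) 1) :
    Tendsto (fun ε : ℝ => ∫ x in {x ∈ Icc (-1:ℝ) 1 | ε ≤ ‖A.Ξ x - A.Ξ x₀‖}, ((x:ℂ) - x₀)⁻¹)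
      (𝓝[>] 0) (𝓝 (Real.log (1 - x₀) - Real.log (1 + x₀))) := by
  have hx₀' := Ioo_subset_Icc_self hx₀
  obtain ⟨b, hb, hbd⟩ := A.exists_le_norm_sub hx₀'
  have h := _root_.tendsto_integral_inv_truncated hx₀ (A.norm_sub_continuousOn (A.Ξ x₀))
    (a := ‖deriv A.Ξ x₀‖) (b := b)
    (norm_pos_iff.2 (A.deriv_ne_zero (A.ofReal_mem_U hx₀'))) hb
    (fun x hx => by
      have := hbd.self_of_nhds x hx
      rwa [← ofReal_sub, norm_real] at this) (by simp)
    (by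
      have := (hasDerivAt_iff_tendsto_slope.1 (A.hasDerivAt hx₀')).norm
      refine this.congr fun x => ?_
      rw [slope_def_module, norm_smul, norm_inv, Real.norm_eq_abs, div_eq_inv_mul])
  have h2 := (continuous_ofReal.tendsto _).comp h
  rw [ofReal_sub] at h2
  refine h2.congr fun ε => ?_
  simp only [Function.comp_apply]
  rw [← integral_complex_ofReal]
  simp

theorem integrableOn_inv_truncated {x₀ : ℝ} {ε : ℝ} (hε : 0 < ε) :
    IntegrableOn (fun x : ℝ => ((x:ℂ) - x₀)⁻¹)
      {x ∈ Icc (-1:ℝ) 1 | ε ≤ ‖A.Ξ x - A.Ξ x₀‖} := by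
  refine ContinuousOn.integrableOn_compact
    (isCompact_truncation (A.norm_sub_continuousOn (A.Ξ x₀)) ε) ?_
  refine ContinuousOn.inv₀ (by fun_prop) fun x hx h => ?_
  have h2 := hx.2
  rw [sub_eq_zero.1 h, sub_self, norm_zero] at h2
  exact absurd h2 (not_le.2 hε)

theorem exists_of_mem_arcInt {τ : ℂ} (hτ : τ ∈ A.arcInt) :
    ∃ x₀ ∈ Ioo (-1:ℝ) 1, A.Ξ x₀ = τ := by
  obtain ⟨⟨-, ⟨x, hx, rfl⟩, rfl⟩, hn⟩ := hτ
  simp only [mem_insert_iff, mem_singleton_iff, not_or] at hn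
  refine ⟨x, ⟨lt_of_le_of_ne hx.1 ?_, lt_of_le_of_ne hx.2 ?_⟩, rfl⟩
  · rintro rfl
    exact hn.2 (by simp [A.map_neg_one])
  · rintro rfl
    exact hn.1 (by simp [A.map_one])

end AnalyticArc

namespace SqrtBranch
variable {A : AnalyticArc} {S : SqrtBranch A} {srp : ℂ → ℂ} (hsrp : BVplus A.Ξ S.sr srp)
include hsrp

theorem integrableOn_truncated {x₀ ε : ℝ} (hε : 0 < ε) :
    IntegrableOn (fun x : ℝ => deriv A.Ξ x / srp (A.Ξ x) / (A.Ξ x - A.Ξ x₀))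
      {x ∈ Icc (-1:ℝ) 1 | ε ≤ ‖A.Ξ x - A.Ξ x₀‖} := by
  have hT := isCompact_truncation (A.norm_sub_continuousOn (A.Ξ x₀)) ε
  have hg := ((integrableOn_Icc_iff_integrableOn_Ioo enorm_ne_top enorm_ne_top).2 (density_integrableOn hsrp)).mono_set
    (s := {x ∈ Icc (-1:ℝ) 1 | ε ≤ ‖A.Ξ x - A.Ξ x₀‖}) fun x hx => hx.1
  refine (hg.norm.const_mul ε⁻¹).mono' (hg.aestronglyMeasurable.aemeasurable.div
    (ContinuousOn.aemeasurable ?_ hT.measurableSet)).aestronglyMeasurable ?_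
  · exact (A.continuousOn_Icc.sub continuousOn_const).mono fun x hx => hx.1
  · filter_upwards [ae_restrict_mem hT.measurableSet] with x hx
    rw [norm_div, div_eq_inv_mul]
    gcongr
    exact hx.2

theorem tendsto_integral_truncated {x₀ : ℝ} (hx₀ : x₀ ∈ Ioo (-1:ℝ) 1) :
    Tendsto (fun ε : ℝ => ∫ x in {x ∈ Icc (-1:ℝ) 1 | ε ≤ ‖A.Ξ x - A.Ξ x₀‖},
      deriv A.Ξ x / srp (A.Ξ x) / (A.Ξ x - A.Ξ x₀)) (𝓝[>] 0) (𝓝 0) := by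
  have h1 := tendsto_setIntegral_truncation (A.norm_sub_continuousOn (A.Ξ x₀))
    (A.norm_sub_pos (Ioo_subset_Icc_self hx₀)) (tendsto_integral_remainder hsrp hx₀).1
  have h2 := (A.tendsto_integral_inv_truncated hx₀).const_mul (srp (A.Ξ x₀))⁻¹
  have h3 := h1.add h2
  rw [(remainder_add_log_eq_zero hsrp hx₀).1] at h3
  refine h3.congr' ?_
  filter_upwards [self_mem_nhdsWithin] with ε hε
  simp only [div_eq_mul_inv (srp (A.Ξ x₀))⁻¹]
  rw [integral_sub (integrableOn_truncated hsrp hε)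
    ((A.integrableOn_inv_truncated hε).const_mul _), integral_const_mul]
  ring

theorem poly_density_integrableOn (p : ℂ[X]) :
    IntegrableOn (fun x : ℝ => p.eval (A.Ξ x) * (deriv A.Ξ x / srp (A.Ξ x))) (Ioo (-1) 1) := by
  rw [← integrableOn_Icc_iff_integrableOn_Ioo]
  refine ((integrableOn_Icc_iff_integrableOn_Ioo enorm_ne_top enorm_ne_top).2 (density_integrableOn hsrp)).continuousOn_mul
    ?_ isCompact_Icc
  exact p.continuous.comp_continuousOn A.continuousOn_Icc

/-- The principal value of a polynomial divided by `sr⁺` is a polynomial of lower degree. -/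
theorem exists_polynomial_isPV (n : ℕ) : ∀ p : ℂ[X], p.natDegree ≤ n →
    ∃ q : ℂ[X], q.degree < n ∧
      ∀ τ ∈ A.arcInt, IsPV A (fun t => p.eval t / srp t) τ (Real.pi * I * q.eval τ) := by
  induction n with
  | zero =>
    intro p hp
    refine ⟨0, by simp, fun τ hτ => ?_⟩
    obtain ⟨x₀, hx₀, rfl⟩ := A.exists_of_mem_arcInt hτ
    rw [eq_C_of_natDegree_le_zero hp]
    have h := (tendsto_integral_truncated hsrp hx₀).const_mul (p.coeff 0)
    simp only [eval_zero, mul_zero] at h ⊢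
    refine h.congr fun ε => ?_
    rw [← integral_const_mul]
    refine integral_congr_ae (Eventually.of_forall fun x => ?_)
    simp only [eval_C]
    ring
  | succ n ih =>
    intro p hp
    obtain ⟨q, hq, h⟩ := ih p.divX (by rw [natDegree_divX_eq_natDegree_tsub_one]; omega)
    set m := ∫ x in Ioo (-1:ℝ) 1, p.divX.eval (A.Ξ x) * (deriv A.Ξ x / srp (A.Ξ x))
    refine ⟨q * X + C (m / (Real.pi * I)), ?_, fun τ hτ => ?_⟩
    · rw [degree_lt_iff_coeff_zero] at hq ⊢
      rintro (_ | k) hk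
      · omega
      · rw [coeff_add, coeff_mul_X, coeff_C_succ, add_zero]
        exact hq k (by omega)
    · have hP := h τ hτ
      obtain ⟨x₀, hx₀, rfl⟩ := A.exists_of_mem_arcInt hτ
      have h0 := (tendsto_integral_truncated hsrp hx₀).const_mul (p.coeff 0)
      have hm := tendsto_setIntegral_truncation (A.norm_sub_continuousOn (A.Ξ x₀))
        (A.norm_sub_pos (Ioo_subset_Icc_self hx₀)) (poly_density_integrableOn hsrp p.divX)
      have hs := (hm.add (hP.const_mul (A.Ξ x₀))).add h0
      have hpi : (Real.pi : ℂ) * I ≠ 0 :=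
        mul_ne_zero (ofReal_ne_zero.2 Real.pi_ne_zero) I_ne_zero
      have e : m + A.Ξ x₀ * (Real.pi * I * q.eval (A.Ξ x₀)) + p.coeff 0 * 0 =
          Real.pi * I * (q * X + C (m / (Real.pi * I))).eval (A.Ξ x₀) := by
        simp only [eval_add, eval_mul, eval_X, eval_C]
        rw [mul_add, mul_div_cancel₀ _ hpi]
        ring
      rw [e] at hs
      refine hs.congr' ?_
      filter_upwards [self_mem_nhdsWithin] with ε hε
      have hT := isCompact_truncation (A.norm_sub_continuousOn (A.Ξ x₀)) ε
      have hi := integrableOn_truncated hsrp (x₀ := x₀) hε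
      have hi1 : IntegrableOn (fun x : ℝ => p.divX.eval (A.Ξ x) * (deriv A.Ξ x / srp (A.Ξ x)))
          {x ∈ Icc (-1:ℝ) 1 | ε ≤ ‖A.Ξ x - A.Ξ x₀‖} :=
        ((integrableOn_Icc_iff_integrableOn_Ioo enorm_ne_top enorm_ne_top).2 (poly_density_integrableOn hsrp p.divX)).mono_set
          fun x hx => hx.1
      have hi2 : IntegrableOn (fun x : ℝ => p.divX.eval (A.Ξ x) / srp (A.Ξ x) /
          (A.Ξ x - A.Ξ x₀) * deriv A.Ξ x) {x ∈ Icc (-1:ℝ) 1 | ε ≤ ‖A.Ξ x - A.Ξ x₀‖} := by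
        have := hi.continuousOn_mul (g := fun x : ℝ => p.divX.eval (A.Ξ x))
          (p.divX.continuous.comp_continuousOn (A.continuousOn_Icc.mono fun x hx => hx.1)) hT
        refine this.congr (Eventually.of_forall fun x => ?_)
        ring
      rw [← integral_const_mul, ← integral_const_mul, ← integral_add hi1 (hi2.const_mul _)]
      refine (integral_add (hi1.add (hi2.const_mul _)) (hi.const_mul _)).symm.trans ?_
      refine setIntegral_congr_fun hT.measurableSet fun x hx => ?_
      have hne : A.Ξ x - A.Ξ x₀ ≠ 0 := norm_pos_iff.1 (lt_of_lt_of_le hε hx.2)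
      have hp : p.eval (A.Ξ x) = p.divX.eval (A.Ξ x) * A.Ξ x + p.coeff 0 := by
        conv_lhs => rw [← divX_mul_X_add p]
        simp
      simp only [hp, Pi.add_apply]
      field_simp
      ring

end SqrtBranch

/-- **Singular and Cauchy integrals of `ℓ₀/sr⁺`.**
For a polynomial `ℓ₀ ≠ 0`, the singular integral `S(ℓ₀/sr⁺)` coincides on `Δ°` with a
polynomial `ℓ₁` of degree strictly smaller than `deg ℓ₀`; in particular `S(1/sr⁺) ≡ 0`
on `Δ°`.  Moreover the Cauchy integral satisfies `C(1/sr⁺)(z) = 1/(2 sr z)` on `D`,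
i.e. `∫_Δ (1/sr⁺(t))/(t-z) dt = 2πi · 1/(2 sr z)`. -/
theorem singular_integral_of_poly_over_sr (A : AnalyticArc) (S : SqrtBranch A)
    (srp : ℂ → ℂ) (hsrp : BVplus A.Ξ S.sr srp)
    (ℓ₀ : Polynomial ℂ) (hℓ₀ : ℓ₀ ≠ 0) :
    (∃ ℓ₁ : Polynomial ℂ, ℓ₁.degree < ℓ₀.degree ∧
        ∀ τ ∈ A.arcInt,
          IsPV A (fun t => ℓ₀.eval t / srp t) τ ((Real.pi : ℂ) * Complex.I * ℓ₁.eval τ)) ∧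
    (∀ τ ∈ A.arcInt, IsPV A (fun t => 1 / srp t) τ 0) ∧
    (∀ z ∈ A.arcᶜ,
        ∫ x in Set.Icc (-1:ℝ) 1, (1 / srp (A.Ξ (x:ℂ))) / (A.Ξ (x:ℂ) - z) * deriv A.Ξ (x:ℂ) =
          (2 * (Real.pi : ℂ) * Complex.I) * (1 / (2 * S.sr z))) := by
  refine ⟨?_, fun τ hτ => ?_, fun z hz => ?_⟩
  · rw [degree_eq_natDegree hℓ₀]
    exact SqrtBranch.exists_polynomial_isPV hsrp _ _ le_rfl
  · obtain ⟨x₀, hx₀, rfl⟩ := A.exists_of_mem_arcInt hτ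
    refine (SqrtBranch.tendsto_integral_truncated hsrp hx₀).congr fun ε => ?_
    refine integral_congr_ae (Eventually.of_forall fun x => ?_)
    ring
  · rw [integral_Icc_eq_integral_Ioo]
    have e : (2 * (Real.pi : ℂ) * I) * (1 / (2 * S.sr z)) = Real.pi * I / S.sr z := by
      have := S.ne_zero hz
      field_simp
    rw [e, ← SqrtBranch.integral_cauchy hsrp hz]
    refine integral_congr_ae (Eventually.of_forall fun x => ?_)
    ring

end
end
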